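/- arXiv:1802.09049 — 2 statements merged into one kernel-verified Lean document; each statement's English description precedes it below -/
import Mathlib

section
/- Let ℓ and n be integers with n ≥ 6 and 3 ≤ ℓ ≤ n−3, let T be a strongly 10⁹-connected n-vertex tournament and let v ∈ V(T). Then there exist two vertex-disjoint directed cycles C₁ and C₂ in T such that v ∈ V(C₁), |V(C₁)| = ℓ and |V(C₂)| = n − ℓ (so C₁ and C₂ partition V(T)). -/
/-- A digraph on the vertex type `V`, given by its adjacency (directed edge) relation. -/
structure Digr (V : Type) where
  Adj : V → V → Prop

namespace Digr

variable {V : Type}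

/-- No loops. -/
def Loopless (G : Digr V) : Prop := ∀ v, ¬ G.Adj v v

/-- A tournament: every pair of distinct vertices is joined by exactly one directed edge. -/
def IsTournament (G : Digr V) : Prop :=
  G.Loopless ∧ ∀ u v : V, u ≠ v → (G.Adj u v ↔ ¬ G.Adj v u)

/-- A semicomplete digraph: every pair of distinct vertices is joined by at least one
directed edge (edges in both directions are allowed). -/
def IsSemicomplete (G : Digr V) : Prop :=
  G.Loopless ∧ ∀ u v : V, u ≠ v → (G.Adj u v ∨ G.Adj v u)

/-- Out-neighbourhood `N⁺_G(v)`. -/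
def outN (G : Digr V) (v : V) : Set V := {u | G.Adj v u}

/-- In-neighbourhood `N⁻_G(v)`. -/
def inN (G : Digr V) (v : V) : Set V := {u | G.Adj u v}

/-- Union of two digraphs (on the same vertex type). -/
def union (G H : Digr V) : Digr V := ⟨fun a b => G.Adj a b ∨ H.Adj a b⟩

/-- `l` is a directed path of `G` lying inside the vertex set `A`, from `u` to `v`. -/
def IsPathOn (G : Digr V) (A : Set V) (u v : V) (l : List V) : Prop :=
  l.Nodup ∧ l.Chain' G.Adj ∧ (∀ x ∈ l, x ∈ A) ∧ l.head? = some u ∧ l.getLast? = some v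

/-- There is a directed path of `G` inside `A` from `u` to `v`. -/
def Reaches (G : Digr V) (A : Set V) (u v : V) : Prop :=
  ∃ l, G.IsPathOn A u v l

/-- The induced subdigraph of `G` on `W` is strongly `k`-connected: `|W| ≥ k + 1` and for
every ordered pair of distinct vertices of `W` and every `S ⊆ W ∖ {u,v}` with `|S| ≤ k - 1`
there is a directed path from `u` to `v` avoiding `S`. -/
def StronglyConnOn (G : Digr V) (W : Set V) (k : ℕ) : Prop :=
  k + 1 ≤ W.ncard ∧
  ∀ u ∈ W, ∀ v ∈ W, u ≠ v → ∀ S : Set V, S ⊆ W \ {u, v} → S.ncard < k →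
    G.Reaches (W \ S) u v

/-- Strong `c`-connectedness for a real parameter `c` (the condition on the removed set `S`
is `|S| ≤ c - 1`). -/
def StronglyConnOnR (G : Digr V) (W : Set V) (c : ℝ) : Prop :=
  c + 1 ≤ (W.ncard : ℝ) ∧
  ∀ u ∈ W, ∀ v ∈ W, u ≠ v → ∀ S : Set V, S ⊆ W \ {u, v} → (S.ncard : ℝ) ≤ c - 1 →
    G.Reaches (W \ S) u v

/-- `l` is a directed cycle of `G` (length at least 3) whose vertex set is `C`. -/
def IsCycleOn (G : Digr V) (C : Set V) (l : List V) : Prop :=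
  3 ≤ l.length ∧ l.Nodup ∧ (∀ x, x ∈ l ↔ x ∈ C) ∧ l.Chain' G.Adj ∧
  ∃ a b, l.getLast? = some a ∧ l.head? = some b ∧ G.Adj a b

/-- The pair `(v, U)` is `k`-connected in the induced subdigraph of `G` on `A`: after
deleting any `S ⊆ A ∖ {v}` with `|S| ≤ k - 1` there is a path from `v` to some vertex
of `U ∖ S` inside `A ∖ S`. -/
def VtxSetConn (G : Digr V) (A : Set V) (v : V) (U : Set V) (k : ℕ) : Prop :=
  ∀ S : Set V, S ⊆ A \ {v} → S.ncard < k → ∃ u ∈ U \ S, G.Reaches (A \ S) v u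

/-- The pair `(U, v)` is `k`-connected in the induced subdigraph of `G` on `A`. -/
def SetVtxConn (G : Digr V) (A : Set V) (U : Set V) (v : V) (k : ℕ) : Prop :=
  ∀ S : Set V, S ⊆ A \ {v} → S.ncard < k → ∃ u ∈ U \ S, G.Reaches (A \ S) u v

end Digr

open Digr

namespace Digr

open Finset

section Strong

variable {V : Type}

theorem IsTournament.ne {T : Digr V} (hT : T.IsTournament) {u v : V} (h : T.Adj u v) : u ≠ v := by
  rintro rfl
  exact hT.1 _ h

theorem IsTournament.adj_of_not_adj {T : Digr V} (hT : T.IsTournament) {u v : V} (huv : u ≠ v)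
    (h : ¬ T.Adj u v) : T.Adj v u :=
  (hT.2 v u huv.symm).2 h

theorem IsTournament.not_adj {T : Digr V} (hT : T.IsTournament) {u v : V} (h : T.Adj u v) :
    ¬ T.Adj v u :=
  (hT.2 u v (hT.ne h)).1 h

/-- The digraph obtained by reversing all edges. -/
def reverse (T : Digr V) : Digr V := ⟨fun a b => T.Adj b a⟩

theorem IsTournament.reverse {T : Digr V} (hT : T.IsTournament) : T.reverse.IsTournament :=
  ⟨hT.1, fun u v huv => hT.2 v u huv.symm⟩

/-- The vertex `z` has both an in-neighbour and an out-neighbour in `Y`. -/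
def Attached (T : Digr V) (Y : Finset V) (z : V) : Prop :=
  (∃ y ∈ Y, T.Adj y z) ∧ ∃ y ∈ Y, T.Adj z y

/-- `b` can be reached from `a` inside `D`. -/
def ReachIn (T : Digr V) (D : Finset V) : V → V → Prop :=
  Relation.ReflTransGen fun a b => a ∈ D ∧ b ∈ D ∧ T.Adj a b

theorem ReachIn.mono {T : Digr V} {D E : Finset V} (h : D ⊆ E) {a b : V} (hab : T.ReachIn D a b) :
    T.ReachIn E a b :=
  Relation.ReflTransGen.mono (fun _ _ hx => ⟨h hx.1, h hx.2.1, hx.2.2⟩) _ _ hab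

theorem ReachIn.of_reverse {T : Digr V} {D : Finset V} {a b : V}
    (h : T.reverse.ReachIn D a b) : T.ReachIn D b a := by
  induction h with
  | refl => exact .refl
  | tail _ hxy ih => exact .head ⟨hxy.2.1, hxy.1, hxy.2.2⟩ ih

/-- `l` lists the vertices of a directed closed walk without repetitions. -/
def IsCyc (T : Digr V) (l : List V) : Prop :=
  l.Nodup ∧ l.IsChain T.Adj ∧ ∀ a ∈ l.getLast?, ∀ b ∈ l.head?, T.Adj a b

theorem IsCyc.append_comm {T : Digr V} {l₁ l₂ : List V} (h : T.IsCyc (l₁ ++ l₂)) :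
    T.IsCyc (l₂ ++ l₁) := by
  rcases eq_or_ne l₁ [] with rfl | h₁
  · simpa using h
  rcases eq_or_ne l₂ [] with rfl | h₂
  · simpa using h
  obtain ⟨hnd, hch, hcl⟩ := h
  rw [List.isChain_append] at hch
  rw [List.getLast?_append_of_ne_nil _ h₂, List.head?_append_of_ne_nil _ h₁] at hcl
  refine ⟨List.nodup_append_comm.1 hnd, ?_, ?_⟩
  · rw [List.isChain_append]
    exact ⟨hch.2.1, hch.1, hcl⟩
  · rw [List.getLast?_append_of_ne_nil _ h₁, List.head?_append_of_ne_nil _ h₂]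
    exact hch.2.2

/-- A list containing an element satisfying `P` splits after the last such element. -/
theorem exists_split_last {l : List V} {P : V → Prop} {x : V} (hx : x ∈ l) (hPx : P x) :
    ∃ l₁ z l₂, l = l₁ ++ z :: l₂ ∧ P z ∧ ∀ a ∈ l₂, ¬ P a := by
  induction l generalizing x with
  | nil => simp at hx
  | cons y l ih =>
    by_cases h : ∃ a ∈ l, P a
    · obtain ⟨a, ha, hPa⟩ := h
      obtain ⟨l₁, z, l₂, rfl, h⟩ := ih ha hPa
      exact ⟨y :: l₁, z, l₂, rfl, h⟩
    · push Not at h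
      rcases List.mem_cons.1 hx with rfl | hxl
      · exact ⟨[], x, l, rfl, hPx, h⟩
      · exact absurd hPx (h x hxl)

/-- A cyclic list on which a predicate takes both values can be rotated so that the predicate
holds at the end and fails at the beginning. -/
theorem IsCyc.exists_rotation {T : Digr V} {l : List V} (hl : T.IsCyc l) {P : V → Prop}
    {x y : V} (hx : x ∈ l) (hy : y ∈ l) (hPx : P x) (hPy : ¬ P y) :
    ∃ l' a b, T.IsCyc l' ∧ l'.Perm l ∧ a ∈ l'.getLast? ∧ b ∈ l'.head? ∧ P a ∧ ¬ P b := by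
  obtain ⟨s, t, rfl⟩ := List.append_of_mem hy
  have hl₁ := hl.append_comm
  have hp₁ : ((y :: t) ++ s).Perm (s ++ y :: t) := List.perm_append_comm
  rw [List.cons_append] at hl₁ hp₁
  have hx₁ : x ∈ y :: (t ++ s) := hp₁.mem_iff.2 hx
  obtain ⟨l₁, z, l₂, heq, hz, h₂⟩ := exists_split_last hx₁ hPx
  have heq' : y :: (t ++ s) = (l₁ ++ [z]) ++ l₂ := by simp [heq]
  rw [heq'] at hl₁ hp₁
  obtain ⟨b, hb, hPb⟩ : ∃ b ∈ (l₂ ++ (l₁ ++ [z])).head?, ¬ P b := by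
    rcases l₂ with _ | ⟨c, l₂⟩
    · refine ⟨y, ?_, hPy⟩
      rw [List.append_nil] at heq'
      simp [← heq']
    · exact ⟨c, by simp, h₂ c (by simp)⟩
  exact ⟨_, z, b, hl₁.append_comm, List.perm_append_comm.trans hp₁,
    by simp [← List.append_assoc], hb, hz, hPb⟩

variable [DecidableEq V]

/-- The subdigraph induced on `W` is strong: every nonempty proper subset of `W` is left by an
edge. -/
def IsStrong (T : Digr V) (W : Finset V) : Prop :=
  ∀ S ⊆ W, S.Nonempty → S ≠ W → ∃ a ∈ S, ∃ b ∈ W \ S, T.Adj a b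

/-- The subdigraph induced on `W` stays strong after deleting fewer than `k` vertices. -/
def IsKStrong (T : Digr V) (k : ℕ) (W : Finset V) : Prop :=
  ∀ D : Finset V, #D < k → T.IsStrong (W \ D)

theorem ReachIn.exists_crossing {T : Digr V} {D S : Finset V} {a b : V} (h : T.ReachIn D a b)
    (ha : a ∈ S) (hb : b ∉ S) : ∃ x ∈ S, ∃ y ∈ D \ S, T.Adj x y := by
  induction h with
  | refl => exact absurd ha hb
  | @tail x y _ hxy ih =>
    by_cases hx : x ∈ S
    · exact ⟨x, hx, y, mem_sdiff.2 ⟨hxy.2.1, hb⟩, hxy.2.2⟩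
    · exact ih hx

theorem isStrong_of_reachIn {T : Digr V} {D : Finset V} {c : V}
    (h : ∀ d ∈ D, T.ReachIn D c d ∧ T.ReachIn D d c) : T.IsStrong D := by
  intro S hS hne hSD
  obtain ⟨a, ha⟩ := hne
  obtain ⟨b, hb, hbS⟩ : ∃ b ∈ D, b ∉ S := by
    by_contra! hcon
    exact hSD (hS.antisymm hcon)
  exact ReachIn.exists_crossing ((h a (hS ha)).2.trans (h b hb).1) ha hbS

theorem IsKStrong.sdiff {T : Digr V} {k j : ℕ} {W D : Finset V} (h : T.IsKStrong k W)
    (hD : #D + j ≤ k) : T.IsKStrong j (W \ D) := by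
  intro D' hD'
  rw [sdiff_sdiff_left]
  refine h _ ((card_union_le _ _).trans_lt ?_)
  omega

theorem IsKStrong.isStrong {T : Digr V} {k : ℕ} {W : Finset V} (h : T.IsKStrong k W)
    (hk : 0 < k) : T.IsStrong W := by
  simpa using h ∅ (by simpa using hk)

/-- A strong set stays strong when vertices are added, provided that every set of new vertices
is both left and entered by an edge. -/
theorem IsStrong.extend {T : Digr V} {Y B : Finset V} (hY : T.IsStrong Y) (hYB : Y ⊆ B)
    (hout : ∀ S ⊆ B \ Y, S.Nonempty → ∃ a ∈ S, ∃ b ∈ B \ S, T.Adj a b)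
    (hin : ∀ S ⊆ B \ Y, S.Nonempty → ∃ a ∈ B \ S, ∃ b ∈ S, T.Adj a b) : T.IsStrong B := by
  intro S hS hne hSB
  by_cases h1 : Disjoint S Y
  · exact hout S (fun x hx => mem_sdiff.2 ⟨hS hx, disjoint_left.1 h1 hx⟩) hne
  by_cases h2 : Y ⊆ S
  · obtain ⟨a, ha, b, hb, hab⟩ := hin (B \ S) (sdiff_subset_sdiff Subset.rfl h2)
      (sdiff_nonempty.2 fun h => hSB (hS.antisymm h))
    rw [Finset.sdiff_sdiff_eq_self hS] at ha
    exact ⟨a, ha, b, hb, hab⟩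
  · obtain ⟨a, ha, b, hb, hab⟩ := hY (S ∩ Y) inter_subset_right
      (not_disjoint_iff_nonempty_inter.1 h1) (fun h => h2 (inter_eq_right.1 h))
    simp only [mem_inter, mem_sdiff, not_and] at ha hb
    exact ⟨a, ha.1, b, mem_sdiff.2 ⟨hYB hb.1, fun h => hb.2 h hb.1⟩, hab⟩

theorem IsStrong.of_attached {T : Digr V} {Y B : Finset V} (hY : T.IsStrong Y) (hYB : Y ⊆ B)
    (h : ∀ z ∈ B \ Y, T.Attached Y z) : T.IsStrong B := by
  refine hY.extend hYB ?_ ?_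
  · rintro S hS ⟨z, hz⟩
    obtain ⟨-, y, hy, hzy⟩ := h z (hS hz)
    exact ⟨z, hz, y, mem_sdiff.2 ⟨hYB hy, fun hyS => (mem_sdiff.1 (hS hyS)).2 hy⟩, hzy⟩
  · rintro S hS ⟨z, hz⟩
    obtain ⟨⟨y, hy, hyz⟩, -⟩ := h z (hS hz)
    exact ⟨y, mem_sdiff.2 ⟨hYB hy, fun hyS => (mem_sdiff.1 (hS hyS)).2 hy⟩, z, hz, hyz⟩

theorem IsStrong.union {T : Digr V} {Y G : Finset V} (hY : T.IsStrong Y) (hG : T.IsStrong G)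
    (hYG : Disjoint Y G) {z : V} (hz : z ∈ G) (hzY : T.Attached Y z) : T.IsStrong (Y ∪ G) := by
  obtain ⟨⟨y₁, hy₁, h₁⟩, y₂, hy₂, h₂⟩ := hzY
  have hGY : (Y ∪ G) \ Y = G := by
    rw [union_sdiff_left, sdiff_eq_self_of_disjoint hYG.symm]
  refine hY.extend subset_union_left ?_ ?_
  · intro S hS hne
    rw [hGY] at hS
    by_cases hSG : S = G
    · subst hSG
      exact ⟨z, hz, y₂, mem_sdiff.2 ⟨mem_union_left _ hy₂, disjoint_left.1 hYG hy₂⟩, h₂⟩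
    · obtain ⟨a, ha, b, hb, hab⟩ := hG S hS hne hSG
      exact ⟨a, ha, b, sdiff_subset_sdiff subset_union_right Subset.rfl hb, hab⟩
  · intro S hS hne
    rw [hGY] at hS
    by_cases hSG : S = G
    · subst hSG
      exact ⟨y₁, mem_sdiff.2 ⟨mem_union_left _ hy₁, disjoint_left.1 hYG hy₁⟩, z, hz, h₁⟩
    · obtain ⟨a, ha, b, hb, hab⟩ := hG (G \ S) sdiff_subset
        (sdiff_nonempty.2 fun h => hSG (hS.antisymm h))
        (fun h => by
          obtain ⟨x, hx⟩ := hne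
          have := hS hx
          rw [← h] at this
          exact (mem_sdiff.1 this).2 hx)
      rw [Finset.sdiff_sdiff_eq_self hS] at hb
      exact ⟨a, sdiff_subset_sdiff subset_union_right Subset.rfl ha, b, hb, hab⟩

/-! ### Cycles of all lengths through a vertex -/

/-- Three vertices forming a cyclic pattern with a common nonempty set span a strong set. -/
theorem isStrong_of_triangles {T : Digr V} {A : Finset V} {p q : V} (hA : A.Nonempty)
    (hqp : T.Adj q p) (hp : ∀ a ∈ A, T.Adj p a) (hq : ∀ a ∈ A, T.Adj a q) :
    T.IsStrong (insert p (insert q A)) := by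
  obtain ⟨c, hc⟩ := hA
  have hpD : p ∈ insert p (insert q A) := mem_insert_self _ _
  have hqD : q ∈ insert p (insert q A) := by simp
  have hmem : ∀ a ∈ A, a ∈ insert p (insert q A) := fun a ha => by simp [ha]
  have h_pq : T.ReachIn (insert p (insert q A)) q p := .single ⟨hqD, hpD, hqp⟩
  have hp' : ∀ a ∈ A, T.ReachIn (insert p (insert q A)) p a :=
    fun a ha => .single ⟨hpD, hmem a ha, hp a ha⟩
  have hq' : ∀ a ∈ A, T.ReachIn (insert p (insert q A)) a q :=
    fun a ha => .single ⟨hmem a ha, hqD, hq a ha⟩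
  refine isStrong_of_reachIn (c := p) fun d hd => ?_
  simp only [mem_insert] at hd
  rcases hd with rfl | rfl | hd
  · exact ⟨.refl, .refl⟩
  · exact ⟨(hp' c hc).trans (hq' c hc), h_pq⟩
  · exact ⟨hp' d hd, (hq' d hd).trans h_pq⟩

/-- In a strong tournament on `W`, either some vertex outside `A` is attached to `A`, or there is
an edge from the out-neighbours of `A` to the in-neighbours of `A`. -/
theorem IsTournament.exists_extension {T : Digr V} (hT : T.IsTournament) {W A : Finset V}
    (hW : T.IsStrong W) (hAW : A ⊆ W) (hA : A.Nonempty) (hne : A ≠ W) :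
    (∃ w ∈ W \ A, T.Attached A w) ∨
      ∃ p ∈ W \ A, ∃ q ∈ W \ A, T.Adj q p ∧ (∀ a ∈ A, T.Adj p a) ∧ ∀ a ∈ A, T.Adj a q := by
  by_cases hatt : ∃ w ∈ W \ A, T.Attached A w
  · exact .inl hatt
  right
  push Not at hatt
  classical
  set N := (W \ A).filter fun w => ∀ a ∈ A, T.Adj a w with hN
  have hin : ∀ w ∈ W \ A, ∀ a ∈ A, T.Adj a w → w ∈ N := by
    intro w hw a ha haw
    refine mem_filter.2 ⟨hw, fun b hb => ?_⟩
    refine hT.adj_of_not_adj ?_ fun h => hatt w hw ⟨⟨a, ha, haw⟩, b, hb, h⟩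
    rintro rfl
    exact (mem_sdiff.1 hw).2 hb
  obtain ⟨a, ha, b, hb, hab⟩ := hW A hAW hA hne
  have hbN := hin b hb a ha hab
  have hNW : N ⊆ W := (filter_subset _ _).trans sdiff_subset
  obtain ⟨q, hq, p, hp, hqp⟩ := hW N hNW ⟨b, hbN⟩ (fun h => by
    have := hAW ha
    rw [← h, hN, mem_filter, mem_sdiff] at this
    exact this.1.2 ha)
  have hqN := mem_filter.1 hq
  obtain ⟨hpW, hpN⟩ := mem_sdiff.1 hp
  have hpA : p ∉ A := fun h => hT.not_adj hqp (hqN.2 p h)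
  have hpWA : p ∈ W \ A := mem_sdiff.2 ⟨hpW, hpA⟩
  refine ⟨p, hpWA, q, hqN.1, hqp, fun c hc => ?_, hqN.2⟩
  refine hT.adj_of_not_adj ?_ fun h => hpN (hin p hpWA c hc h)
  rintro rfl
  exact hpA hc

/-- Every vertex of a strong tournament lies on a directed triangle. -/
theorem IsTournament.exists_triangle {T : Digr V} (hT : T.IsTournament) {W : Finset V}
    (hW : T.IsStrong W) (h3 : 3 ≤ #W) {v : V} (hv : v ∈ W) :
    ∃ p ∈ W, ∃ q ∈ W, T.Adj q p ∧ T.Adj p v ∧ T.Adj v q := by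
  rcases hT.exists_extension hW (singleton_subset_iff.2 hv) (singleton_nonempty v)
    (fun h => by rw [← h] at h3; simp at h3) with ⟨w, _, ⟨y, hy, h1⟩, y', hy', h2⟩ |
      ⟨p, hp, q, hq, hqp, h1, h2⟩
  · rw [mem_singleton] at hy hy'
    subst hy hy'
    exact absurd h2 (hT.not_adj h1)
  · exact ⟨p, (mem_sdiff.1 hp).1, q, (mem_sdiff.1 hq).1, hqp, h1 v (by simp), h2 v (by simp)⟩

/-- In a strong tournament, every vertex lies in strong subtournaments of all orders at
least three. -/
theorem IsTournament.exists_strong_subset {T : Digr V} (hT : T.IsTournament)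
    {W : Finset V} (hW : T.IsStrong W) {v : V} (hv : v ∈ W) {m : ℕ} (h3 : 3 ≤ m) (hm : m ≤ #W) :
    ∃ A ⊆ W, v ∈ A ∧ #A = m ∧ T.IsStrong A := by
  induction m, h3 using Nat.le_induction with
  | base =>
    obtain ⟨p, hp, q, hq, hqp, hpv, hvq⟩ := hT.exists_triangle hW hm hv
    refine ⟨insert p (insert q {v}), ?_, by simp, ?_,
      isStrong_of_triangles (by simp) hqp (by simpa using hpv) (by simpa using hvq)⟩
    · rw [insert_subset_iff, insert_subset_iff, singleton_subset_iff]
      exact ⟨hp, hq, hv⟩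
    · exact card_eq_three.2 ⟨p, q, v, (hT.ne hqp).symm, hT.ne hpv, (hT.ne hvq).symm, rfl⟩
  | succ m h3 ih =>
    obtain ⟨A, hAW, hvA, hcard, hA⟩ := ih (by omega)
    rcases hT.exists_extension hW hAW ⟨v, hvA⟩ (fun h => by rw [← h] at hm; omega) with
      ⟨w, hw, hatt⟩ | ⟨p, hp, q, hq, hqp, h1, h2⟩
    · obtain ⟨hwW, hwA⟩ := mem_sdiff.1 hw
      refine ⟨insert w A, insert_subset hwW hAW, mem_insert_of_mem hvA, ?_,
        hA.of_attached (subset_insert _ _) ?_⟩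
      · rw [card_insert_of_notMem hwA, hcard]
      · intro z hz
        simp only [mem_sdiff, mem_insert] at hz
        obtain rfl : z = w := hz.1.resolve_right hz.2
        exact hatt
    · obtain ⟨u, hu, huv⟩ := exists_mem_ne (by omega : 1 < #A) v
      obtain ⟨hpW, hpA⟩ := mem_sdiff.1 hp
      obtain ⟨hqW, hqA⟩ := mem_sdiff.1 hq
      refine ⟨insert p (insert q (A.erase u)), ?_, by simp [hvA, huv.symm], ?_,
        isStrong_of_triangles ⟨v, mem_erase.2 ⟨huv.symm, hvA⟩⟩ hqp
          (fun a ha => h1 a (mem_of_mem_erase ha)) fun a ha => h2 a (mem_of_mem_erase ha)⟩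
      · rw [insert_subset_iff, insert_subset_iff]
        exact ⟨hpW, hqW, (erase_subset _ _).trans hAW⟩
      · rw [card_insert_of_notMem, card_insert_of_notMem, card_erase_of_mem hu]
        · omega
        · exact fun h => hqA (mem_of_mem_erase h)
        · simp only [mem_insert, mem_erase, not_or, not_and]
          exact ⟨(hT.ne hqp).symm, fun _ => hpA⟩

/-! ### Hamiltonian cycles -/

theorem IsTournament.exists_longer_isCyc {T : Digr V} (hT : T.IsTournament) {W : Finset V}
    (hW : T.IsStrong W) {l : List V} (hl : T.IsCyc l) (hlW : l.toFinset ⊆ W) (hne : l ≠ [])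
    (hlW' : l.toFinset ≠ W) :
    ∃ l', T.IsCyc l' ∧ l'.toFinset ⊆ W ∧ l.length < l'.length := by
  rcases hT.exists_extension hW hlW ((List.toFinset_nonempty_iff l).2 hne) hlW' with
    ⟨w, hw, ⟨x, hx, hxw⟩, y, hy, hwy⟩ | ⟨p, hp, q, hq, hqp, h1, h2⟩
  · rw [List.mem_toFinset] at hx hy
    obtain ⟨hwW, hwl⟩ := mem_sdiff.1 hw
    rw [List.mem_toFinset] at hwl
    obtain ⟨l', a, b, hl', hp, ha, hb, hPa, hPb⟩ :=
      hl.exists_rotation (P := fun z => T.Adj z w) hx hy hxw (hT.not_adj hwy)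
    have hwl' : w ∉ l' := fun h => hwl (hp.mem_iff.1 h)
    have hwb : T.Adj w b := by
      refine hT.adj_of_not_adj ?_ hPb
      rintro rfl
      exact hwl' (List.mem_of_mem_head? hb)
    have hl'ne : l' ≠ [] := by
      rintro rfl
      simp at hb
    refine ⟨w :: l', ⟨List.nodup_cons.2 ⟨hwl', hl'.1⟩, ?_, ?_⟩, ?_, ?_⟩
    · rw [List.isChain_cons]
      refine ⟨fun c hc => ?_, hl'.2.1⟩
      rwa [Option.mem_unique hc hb]
    · intro c hc d hd
      rw [List.getLast?_cons_of_ne_nil hl'ne] at hc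
      obtain rfl : w = d := by simpa using hd
      rwa [Option.mem_unique hc ha]
    · rw [List.toFinset_cons, List.toFinset_eq_of_perm _ _ hp]
      exact insert_subset hwW hlW
    · simp [hp.length_eq]
  · simp only [mem_sdiff, List.mem_toFinset] at hp hq h1 h2
    refine ⟨q :: p :: l, ⟨?_, ?_, ?_⟩, ?_, by simp⟩
    · simp [hp.2, hq.2, hl.1, hT.ne hqp]
    · rw [List.isChain_cons_cons, List.isChain_cons]
      exact ⟨hqp, fun c hc => h1 c (List.mem_of_mem_head? hc), hl.2.1⟩
    · intro c hc d hd
      rw [List.getLast?_cons_cons, List.getLast?_cons_of_ne_nil hne] at hc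
      obtain rfl : q = d := by simpa using hd
      exact h2 c (List.mem_of_mem_getLast? hc)
    · rw [List.toFinset_cons, List.toFinset_cons]
      exact insert_subset hq.1 (insert_subset hp.1 hlW)

/-- A strong tournament on at least three vertices has a Hamiltonian cycle. -/
theorem IsTournament.exists_isCycleOn {T : Digr V} (hT : T.IsTournament) {W : Finset V}
    (hW : T.IsStrong W) (h3 : 3 ≤ #W) : ∃ l, T.IsCycleOn (W : Set V) l := by
  have key : ∀ j l, T.IsCyc l → l.toFinset ⊆ W → l ≠ [] → #W - l.length = j →
      ∃ l', T.IsCyc l' ∧ l'.toFinset = W := by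
    intro j
    induction j using Nat.strong_induction_on with
    | _ j ih =>
      intro l hl hlW hne hj
      by_cases hlW' : l.toFinset = W
      · exact ⟨l, hl, hlW'⟩
      obtain ⟨l', hl', hl'W, hlt⟩ := hT.exists_longer_isCyc hW hl hlW hne hlW'
      have hcard := card_le_card hl'W
      rw [List.toFinset_card_of_nodup hl'.1] at hcard
      refine ih _ ?_ l' hl' hl'W ?_ rfl
      · omega
      · rintro rfl
        simp at hlt
  obtain ⟨v, hv⟩ : W.Nonempty := card_pos.1 (by omega)
  have hone : ∃ l, T.IsCyc l ∧ l.toFinset ⊆ W ∧ l ≠ [] := by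
    obtain ⟨p, hp, q, hq, hqp, hpv, hvq⟩ := hT.exists_triangle hW h3 hv
    refine ⟨[v, q, p], ⟨?_, ?_, ?_⟩, ?_, by simp⟩
    · simp [hT.ne hvq, hT.ne hqp, (hT.ne hpv).symm]
    · simp [hvq, hqp]
    · simpa using hpv
    · simp [insert_subset_iff, hp, hq, hv]
  obtain ⟨l₀, h0, h0W, h0ne⟩ := hone
  obtain ⟨l, hl, hlW⟩ := key _ l₀ h0 h0W h0ne rfl
  have hlen : l.length = #W := by rw [← hlW, List.toFinset_card_of_nodup hl.1]
  have hne : l ≠ [] := by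
    rintro rfl
    simp at hlen
    omega
  refine ⟨l, by omega, hl.1, fun x => by simp [← hlW], hl.2.1, l.getLast hne, l.head hne,
    List.getLast?_eq_getLast_of_ne_nil hne, List.head?_eq_some_head hne, ?_⟩
  exact hl.2.2 _ (List.getLast?_eq_getLast_of_ne_nil hne) _ (List.head?_eq_some_head hne)

/-! ### Small sets dominating most vertices -/

open scoped Classical in
theorem IsTournament.exists_two_mul_indegree_le {T : Digr V} (hT : T.IsTournament) {M : Finset V}
    (hM : M.Nonempty) : ∃ m ∈ M, 2 * #{z ∈ M | T.Adj z m} ≤ #M := by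
  have hsum : ∑ m ∈ M, #{z ∈ M | T.Adj z m} ≤ ∑ m ∈ M, #{z ∈ M | T.Adj m z} :=
    (sum_card_bipartiteAbove_eq_sum_card_bipartiteBelow T.Adj (s := M) (t := M)).ge
  obtain ⟨m, hm, hle⟩ := exists_le_of_sum_le hM hsum
  refine ⟨m, hm, ?_⟩
  have hdisj : Disjoint {z ∈ M | T.Adj z m} {z ∈ M | T.Adj m z} :=
    disjoint_filter.2 fun z _ h => hT.not_adj h
  have := card_le_card (union_subset (filter_subset (fun z => T.Adj z m) M)
    (filter_subset (fun z => T.Adj m z) M))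
  rw [card_union_of_disjoint hdisj] at this
  omega

/-- There is a small set `D` containing `w₀`, with a source `s` inside `D`, such that all but a
`2⁻ᶜ`-proportion of the vertices are dominated by some vertex of `D`. -/
theorem IsTournament.exists_dominating {T : Digr V} (hT : T.IsTournament) {W : Finset V} {w₀ : V}
    (hw₀ : w₀ ∈ W) (c : ℕ) :
    ∃ D ⊆ W, w₀ ∈ D ∧ #D ≤ c + 1 ∧
      (∃ s ∈ D, ∀ d ∈ D, T.ReachIn D s d ∧ T.ReachIn D d w₀) ∧
      ∀ E ⊆ W \ D, (∀ z ∈ E, ∀ d ∈ D, T.Adj z d) → 2 ^ c * #E ≤ #W := by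
  classical
  induction c with
  | zero =>
    refine ⟨{w₀}, singleton_subset_iff.2 hw₀, by simp, by simp, ⟨w₀, by simp, ?_⟩, ?_⟩
    · intro d hd
      obtain rfl := mem_singleton.1 hd
      exact ⟨.refl, .refl⟩
    · intro E hE _
      simpa using card_le_card (hE.trans sdiff_subset)
  | succ c ih =>
    obtain ⟨D, hDW, hwD, hcard, ⟨s, hs, hreach⟩, hE⟩ := ih
    set M := (W \ D).filter fun z => ∀ d ∈ D, T.Adj z d with hM
    rcases M.eq_empty_or_nonempty with hM0 | hM0
    · refine ⟨D, hDW, hwD, by omega, ⟨s, hs, hreach⟩, fun E hED hEd => ?_⟩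
      have : E = ∅ := by
        rw [← subset_empty, ← hM0]
        exact fun z hz => mem_filter.2 ⟨hED hz, hEd z hz⟩
      simp [this]
    · obtain ⟨m, hm, hle⟩ := hT.exists_two_mul_indegree_le hM0
      obtain ⟨hmWD, hmD⟩ := mem_filter.1 hm
      obtain ⟨hmW, hmnD⟩ := mem_sdiff.1 hmWD
      have hstep : ∀ d ∈ D, T.ReachIn (insert m D) m d := fun d hd =>
        .single ⟨mem_insert_self _ _, mem_insert_of_mem hd, hmD d hd⟩
      refine ⟨insert m D, insert_subset hmW hDW, mem_insert_of_mem hwD, ?_,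
        ⟨m, mem_insert_self _ _, ?_⟩, ?_⟩
      · rw [card_insert_of_notMem hmnD]
        omega
      · intro d hd
        rcases mem_insert.1 hd with rfl | hd
        · exact ⟨.refl, hstep _ hwD⟩
        · exact ⟨hstep d hd, (hreach d hd).2.mono (subset_insert _ _)⟩
      · intro E hEW hEd
        have h1 := hE M (filter_subset _ _) fun z hz => (mem_filter.1 hz).2
        have h2 : #E ≤ #{z ∈ M | T.Adj z m} := by
          refine card_le_card fun z hz => ?_
          have := mem_sdiff.1 (hEW hz)
          simp only [mem_insert, not_or] at this
          exact mem_filter.2 ⟨mem_filter.2 ⟨mem_sdiff.2 ⟨this.1, this.2.2⟩,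
            fun d hd => hEd z hz d (mem_insert_of_mem hd)⟩, hEd z hz m (mem_insert_self _ _)⟩
        calc 2 ^ (c + 1) * #E = 2 ^ c * (2 * #E) := by ring
          _ ≤ 2 ^ c * #M := by gcongr; omega
          _ ≤ #W := h1

/-! ### Shortest paths -/

/-- There is a walk of length `n` from `t` to the given vertex inside `W`. -/
def WalkIn (T : Digr V) (W : Finset V) (t : V) : ℕ → V → Prop
  | 0, w => w = t
  | n + 1, w => w ∈ W ∧ ∃ u ∈ W, T.WalkIn W t n u ∧ T.Adj u w

theorem IsStrong.exists_walkIn {T : Digr V} {W : Finset V} (hW : T.IsStrong W) {t w : V}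
    (ht : t ∈ W) (hw : w ∈ W) : ∃ n, T.WalkIn W t n w := by
  classical
  by_contra hcon
  obtain ⟨a, ha, b, hb, hab⟩ := hW {w ∈ W | ∃ n, T.WalkIn W t n w} (filter_subset _ _)
    ⟨t, mem_filter.2 ⟨ht, 0, rfl⟩⟩ (fun h => by
      rw [← h] at hw
      exact hcon (mem_filter.1 hw).2)
  obtain ⟨haW, n, hn⟩ := mem_filter.1 ha
  obtain ⟨hbW, hbn⟩ := mem_sdiff.1 hb
  exact hbn (mem_filter.2 ⟨hbW, n + 1, hbW, a, haW, hn, hab⟩)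

/-- The distance from `t` in a strong digraph. -/
theorem IsStrong.exists_dist {T : Digr V} {W : Finset V} (hW : T.IsStrong W) {t : V}
    (ht : t ∈ W) :
    ∃ f : V → ℕ, f t = 0 ∧ (∀ w ∈ W, f w = 0 → w = t) ∧
      (∀ u ∈ W, ∀ w ∈ W, T.Adj u w → f w ≤ f u + 1) ∧
      ∀ w ∈ W, ∀ i, f w = i + 1 → ∃ u ∈ W, f u = i ∧ T.Adj u w := by
  have hmem : ∀ w ∈ W, T.WalkIn W t (sInf {n | T.WalkIn W t n w}) w :=
    fun w hw => Nat.sInf_mem (hW.exists_walkIn ht hw)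
  have hle : ∀ w n, T.WalkIn W t n w → sInf {n | T.WalkIn W t n w} ≤ n :=
    fun w n h => Nat.sInf_le h
  have hadj : ∀ u ∈ W, ∀ w ∈ W, T.Adj u w →
      sInf {n | T.WalkIn W t n w} ≤ sInf {n | T.WalkIn W t n u} + 1 :=
    fun u hu w hw huw => hle w _ ⟨hw, u, hu, hmem u hu, huw⟩
  refine ⟨fun w => sInf {n | T.WalkIn W t n w}, Nat.le_zero.1 (hle t 0 rfl), ?_, hadj, ?_⟩
  · intro w hw h0
    have := hmem w hw
    dsimp only at h0
    rw [h0] at this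
    exact this
  · intro w hw i hi
    have h := hmem w hw
    dsimp only at hi
    rw [hi] at h
    obtain ⟨-, u, hu, hiu, huw⟩ := h
    refine ⟨u, hu, ?_, huw⟩
    have h1 := hle u i hiu
    have h2 := hadj u hu w hw huw
    dsimp only
    omega

theorem exists_shortest_path {T : Digr V} {W : Finset V} {t : V} {f : V → ℕ}
    (h0 : ∀ w ∈ W, f w = 0 → w = t)
    (hpred : ∀ w ∈ W, ∀ i, f w = i + 1 → ∃ u ∈ W, f u = i ∧ T.Adj u w) (m : ℕ) :
    ∀ s ∈ W, f s = m → ∃ Q ⊆ W, t ∈ Q ∧ s ∈ Q ∧ Set.InjOn f Q ∧ (∀ q ∈ Q, f q ≤ m) ∧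
      #Q ≤ m + 1 ∧ ∀ q ∈ Q, T.ReachIn Q t q ∧ T.ReachIn Q q s := by
  induction m with
  | zero =>
    intro s hs hfs
    obtain rfl := h0 s hs hfs
    refine ⟨{s}, singleton_subset_iff.2 hs, by simp, by simp, by simp, by simp [hfs], by simp, ?_⟩
    intro q hq
    obtain rfl := mem_singleton.1 hq
    exact ⟨.refl, .refl⟩
  | succ m ih =>
    intro s hs hfs
    obtain ⟨u, hu, hfu, hus⟩ := hpred s hs m hfs
    obtain ⟨Q, hQW, htQ, huQ, hinj, hfQ, hcard, hreach⟩ := ih u hu hfu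
    have hsQ : s ∉ Q := fun h => by
      have := hfQ s h
      omega
    have hsub : Q ⊆ insert s Q := subset_insert _ _
    have h_us : T.ReachIn (insert s Q) u s := .single ⟨hsub huQ, mem_insert_self _ _, hus⟩
    refine ⟨insert s Q, insert_subset hs hQW, hsub htQ, mem_insert_self _ _, ?_, ?_, ?_, ?_⟩
    · rw [coe_insert, Set.injOn_insert (by simpa using hsQ)]
      refine ⟨hinj, ?_⟩
      rintro ⟨q, hq, hqs⟩
      have := hfQ q hq
      omega
    · intro q hq
      rcases mem_insert.1 hq with rfl | hq
      · exact hfs.le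
      · exact (hfQ q hq).trans (Nat.le_succ m)
    · rw [card_insert_of_notMem hsQ]
      omega
    · intro q hq
      rcases mem_insert.1 hq with rfl | hq
      · exact ⟨((hreach u huQ).1.mono hsub).trans h_us, .refl⟩
      · exact ⟨(hreach q hq).1.mono hsub, ((hreach q hq).2.mono hsub).trans h_us⟩

/-- In a `k`-strong digraph every intermediate distance level has at least `k` vertices, so
distances are at most about `#W / k`. -/
theorem IsKStrong.mul_dist_le {T : Digr V} {W : Finset V} {k : ℕ} (hW : T.IsKStrong k W)
    {t s : V} (ht : t ∈ W) (hs : s ∈ W) {f : V → ℕ} (hft : f t = 0)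
    (hf : ∀ u ∈ W, ∀ w ∈ W, T.Adj u w → f w ≤ f u + 1) : k * (f s - 1) ≤ #W := by
  have hlevel : ∀ i ∈ Ioo 0 (f s), k ≤ #{w ∈ W | f w = i} := by
    intro i hi
    obtain ⟨hi0, his⟩ := mem_Ioo.1 hi
    by_contra! hlt
    obtain ⟨a, ha, b, hb, hab⟩ := hW _ hlt {w ∈ W | f w < i}
      (fun w hw => by
        obtain ⟨hwW, hwi⟩ := mem_filter.1 hw
        simp only [mem_sdiff, mem_filter, not_and]
        exact ⟨hwW, fun _ => hwi.ne⟩)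
      ⟨t, mem_filter.2 ⟨ht, by omega⟩⟩
      (fun h => by
        have hs' : s ∈ W \ {w ∈ W | f w = i} := by
          simp only [mem_sdiff, mem_filter, not_and]
          exact ⟨hs, fun _ => his.ne'⟩
        rw [← h] at hs'
        have := (mem_filter.1 hs').2
        omega)
    simp only [mem_filter, mem_sdiff, not_and] at ha hb
    have h1 := hf a ha.1 b hb.1.1 hab
    have h2 := hb.1.2 hb.1.1
    have h3 := hb.2 hb.1.1
    omega
  calc k * (f s - 1) = #(Ioo 0 (f s)) • k := by simp [mul_comm]
    _ ≤ ∑ i ∈ Ioo 0 (f s), #{w ∈ W | f w = i} := card_nsmul_le_sum _ _ _ hlevel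
    _ = #{w ∈ W | f w ∈ Ioo 0 (f s)} := sum_card_fiberwise_eq_card_filter _ _ _
    _ ≤ #W := card_filter_le _ _

/-- Deleting part of a shortest path from a tournament lowers its strong connectivity by at most
four. -/
theorem IsKStrong.sdiff_shortest_path {T : Digr V} (hT : T.IsTournament) {W Q : Finset V}
    {k j : ℕ} (hW : T.IsKStrong k W) (hjk : j + 4 ≤ k) {f : V → ℕ}
    (hf : ∀ u ∈ W, ∀ w ∈ W, T.Adj u w → f w ≤ f u + 1) (hQW : Q ⊆ W)
    (hinj : Set.InjOn f Q) : T.IsKStrong j (W \ Q) := by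
  classical
  intro D hD S hS hne hSne
  by_contra! hcon
  obtain ⟨r, hr, hrS⟩ : ∃ r ∈ (W \ Q) \ D, r ∉ S := by
    by_contra! h
    exact hSne (hS.antisymm h)
  have hSW : ∀ s ∈ S, s ∈ W ∧ s ∉ Q ∧ s ∉ D := fun s hs => by
    have := hS hs
    simp only [mem_sdiff] at this
    exact ⟨this.1.1, this.1.2, this.2⟩
  simp only [mem_sdiff] at hr
  set P := Q.filter fun q => q ∉ D ∧ ∃ s ∈ S, T.Adj s q with hP
  rcases P.eq_empty_or_nonempty with hP0 | hP0
  · obtain ⟨a, ha, b, hb, hab⟩ := hW D (by omega) S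
      (hS.trans (sdiff_subset_sdiff sdiff_subset Subset.rfl)) hne (fun h => hrS (by
        rw [h]
        exact mem_sdiff.2 ⟨hr.1.1, hr.2⟩))
    simp only [mem_sdiff] at hb
    by_cases hbQ : b ∈ Q
    · have : b ∈ P := mem_filter.2 ⟨hbQ, hb.1.2, a, ha, hab⟩
      simp [hP0] at this
    · refine hcon a ha b ?_ hab
      simp only [mem_sdiff]
      exact ⟨⟨⟨hb.1.1, hbQ⟩, hb.1.2⟩, hb.2⟩
  obtain ⟨p, hp, hmax⟩ := P.exists_max_image f hP0
  obtain ⟨hpQ, hpD, s₀, hs₀, hs₀p⟩ := mem_filter.1 hp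
  set L := Q.filter fun q => f q ∈ Icc (f p - 3) (f p) with hL
  have hLcard : #L ≤ 4 := by
    have hinjL : Set.InjOn f L := hinj.mono (coe_subset.2 (filter_subset _ _))
    rw [← card_image_of_injOn hinjL]
    refine (card_le_card (image_subset_iff.2 fun q hq => (mem_filter.1 hq).2)).trans ?_
    rw [Nat.card_Icc]
    omega
  obtain ⟨a, ha, b, hb, hab⟩ := hW (D ∪ L) ((card_union_le _ _).trans_lt (by omega))
    {w ∈ W \ (D ∪ L) | w ∈ S ∨ w ∈ Q ∧ f w + 3 < f p} (filter_subset _ _)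
    (by
      obtain ⟨s, hs⟩ := hne
      refine ⟨s, mem_filter.2 ⟨?_, .inl hs⟩⟩
      simp only [mem_sdiff, mem_union, not_or, hL, mem_filter, not_and]
      exact ⟨(hSW s hs).1, (hSW s hs).2.2, fun h => absurd h (hSW s hs).2.1⟩)
    (fun h => by
      have : r ∈ W \ (D ∪ L) := by
        simp only [mem_sdiff, mem_union, not_or, hL, mem_filter, not_and]
        exact ⟨hr.1.1, hr.2, fun h => absurd h hr.1.2⟩
      rw [← h] at this
      rcases (mem_filter.1 this).2 with h | h
      · exact hrS h
      · exact hr.1.2 h.1)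
  simp only [hL, mem_filter, mem_sdiff, mem_union, mem_Icc, not_or, not_and] at ha hb
  obtain ⟨⟨haW, haD, haL⟩, haS⟩ := ha
  obtain ⟨⟨hbW, hbD, hbL⟩, hbS⟩ := hb
  obtain ⟨hbS, hbQ⟩ := hbS ⟨hbW, hbD, hbL⟩
  have hbnew : b ∉ Q → ∀ s ∈ S, T.Adj b s := by
    intro hbQ s hs
    refine hT.adj_of_not_adj ?_ (hcon s hs b (by simp [hbW, hbQ, hbD, hbS]))
    rintro rfl
    exact hbS hs
  rcases haS with haS | ⟨haQ, hfa⟩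
  · by_cases hbQ' : b ∈ Q
    · have h1 := hmax b (mem_filter.2 ⟨hbQ', hbD, a, haS, hab⟩)
      have h2 := hbL hbQ'
      have h3 := hbQ hbQ'
      omega
    · exact hT.not_adj hab (hbnew hbQ' a haS)
  · have h1 := hf a haW b hbW hab
    by_cases hbQ' : b ∈ Q
    · have h2 := hbL hbQ'
      have h3 := hbQ hbQ'
      omega
    · have h2 := hf b hbW s₀ (hSW s₀ hs₀).1 (hbnew hbQ' s₀ hs₀)
      have h3 := hf s₀ (hSW s₀ hs₀).1 p (hQW hpQ) hs₀p
      omega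

/-! ### Small strong sets attached to most vertices -/

theorem IsTournament.exists_hub {T : Digr V} (hT : T.IsTournament) {W : Finset V} {K : ℕ}
    (hW : T.IsKStrong K W) (hK : 100 ≤ K) (hcard : 1000 ≤ #W) {w₀ : V} (hw₀ : w₀ ∈ W) :
    ∃ Y ⊆ W, w₀ ∈ Y ∧ T.IsStrong Y ∧ 20 * #Y ≤ #W ∧
      (∀ E ⊆ W \ Y, (∀ z ∈ E, ¬ T.Attached Y z) → 20 * #E ≤ #W) ∧
      ∀ Y' ⊆ Y, T.IsKStrong (K - 20) (W \ Y') := by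
  classical
  obtain ⟨D, hDW, hwD, hDcard, ⟨s, hsD, hs⟩, hDE⟩ := hT.exists_dominating hw₀ 6
  obtain ⟨D', hDW', hwD', hDcard', ⟨t, htD', ht⟩, hDE'⟩ := hT.reverse.exists_dominating hw₀ 6
  have hsW := hDW hsD
  have htW := hDW' htD'
  obtain ⟨f, hft, hf0, hf, hpred⟩ := (hW.isStrong (by omega)).exists_dist htW
  obtain ⟨Q, hQW, htQ, hsQ, hinj, -, hQcard, hQ⟩ := exists_shortest_path hf0 hpred _ s hsW rfl
  have hdist : 100 * (f s - 1) ≤ #W :=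
    (Nat.mul_le_mul_right _ hK).trans (hW.mul_dist_le htW hsW hft hf)
  have hDD' : #(D ∪ D') ≤ 14 := (card_union_le _ _).trans (by omega)
  set Y := (D ∪ D') ∪ Q with hY
  have hDY : D ⊆ Y := subset_union_left.trans subset_union_left
  have hDY' : D' ⊆ Y := subset_union_right.trans subset_union_left
  have hQY : Q ⊆ Y := subset_union_right
  have hYW : Y ⊆ W := union_subset (union_subset hDW hDW') hQW
  have hwt : T.ReachIn Y w₀ t := (ht w₀ hwD').1.of_reverse.mono hDY'
  have hts : T.ReachIn Y t s := (hQ s hsQ).1.mono hQY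
  have hsw : T.ReachIn Y s w₀ := (hs w₀ hwD).1.mono hDY
  refine ⟨Y, hYW, hDY hwD, isStrong_of_reachIn (c := w₀) fun d hd => ?_, ?_, ?_, ?_⟩
  · rcases mem_union.1 hd with hd | hd
    · rcases mem_union.1 hd with hd | hd
      · exact ⟨(hwt.trans hts).trans ((hs d hd).1.mono hDY), (hs d hd).2.mono hDY⟩
      · exact ⟨(ht d hd).2.of_reverse.mono hDY',
          ((ht d hd).1.of_reverse.mono hDY').trans (hts.trans hsw)⟩
    · exact ⟨hwt.trans ((hQ d hd).1.mono hQY), ((hQ d hd).2.mono hQY).trans hsw⟩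
  · have := card_union_le (D ∪ D') Q
    rw [← hY] at this
    omega
  · intro E hE hEY
    have hEW : ∀ z ∈ E, z ∈ W ∧ z ∉ Y := fun z hz => mem_sdiff.1 (hE hz)
    have h1 := hDE {z ∈ E | ∀ d ∈ D, T.Adj z d}
      (fun z hz => mem_sdiff.2 ⟨(hEW z (mem_filter.1 hz).1).1,
        fun h => (hEW z (mem_filter.1 hz).1).2 (hDY h)⟩) (fun z hz => (mem_filter.1 hz).2)
    have h2 := hDE' {z ∈ E | ∀ d ∈ D', T.reverse.Adj z d}
      (fun z hz => mem_sdiff.2 ⟨(hEW z (mem_filter.1 hz).1).1,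
        fun h => (hEW z (mem_filter.1 hz).1).2 (hDY' h)⟩) (fun z hz => (mem_filter.1 hz).2)
    have h3 : E ⊆ {z ∈ E | ∀ d ∈ D, T.Adj z d} ∪ {z ∈ E | ∀ d ∈ D', T.reverse.Adj z d} := by
      intro z hz
      have hne : ∀ y ∈ Y, z ≠ y := by
        rintro y hy rfl
        exact (hEW z hz).2 hy
      simp only [mem_union, mem_filter, hz, true_and]
      by_contra! hcon
      obtain ⟨⟨d, hd, hzd⟩, d', hd', hzd'⟩ := hcon
      exact hEY z hz ⟨⟨d, hDY hd, hT.adj_of_not_adj (hne d (hDY hd)) hzd⟩, d', hDY' hd',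
        hT.adj_of_not_adj (hne d' (hDY' hd')).symm hzd'⟩
    have h4 := (card_le_card h3).trans (card_union_le _ _)
    omega
  · intro Y' hY'
    have h1 : T.IsKStrong (K - 4) (W \ (Y' ∩ Q)) :=
      hW.sdiff_shortest_path hT (by omega) hf (inter_subset_right.trans hQW)
        (hinj.mono (coe_subset.2 inter_subset_right))
    have h2 : #(Y' \ Q) ≤ 14 := by
      refine (card_le_card fun z hz => ?_).trans hDD'
      obtain ⟨hzY', hzQ⟩ := mem_sdiff.1 hz
      exact (mem_union.1 (hY' hzY')).resolve_right hzQ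
    have h3 : W \ Y' = (W \ (Y' ∩ Q)) \ (Y' \ Q) := by
      rw [sdiff_sdiff_left, sup_eq_union, union_comm, sdiff_union_inter]
    rw [h3]
    exact h1.sdiff (by omega)

theorem IsStrong.reverse {T : Digr V} {W : Finset V} (hW : T.IsStrong W) :
    T.reverse.IsStrong W := by
  intro S hS hne hSW
  obtain ⟨a, ha, b, hb, hab⟩ := hW (W \ S) sdiff_subset
    (sdiff_nonempty.2 fun h => hSW (hS.antisymm h))
    (fun h => hne.ne_empty ((Finset.sdiff_eq_self_iff_disjoint.1 h).eq_bot_of_ge hS))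
  exact ⟨b, by simpa [inter_eq_right.2 hS] using hb, a, ha, hab⟩

/-- Every set of vertices outside `A ∪ Y` is left by an edge avoiding `A`. -/
theorem exists_adj_compl [Fintype V] {T : Digr V} {X Y E A : Finset V} (hY : Y.Nonempty)
    (hAY : Disjoint A Y) (hstrong : T.IsStrong (univ \ (A ∩ X)))
    (hE : ∀ z ∉ Y, z ∉ E → ∃ y ∈ Y, T.Adj z y)
    (hres : ∀ z ∈ E, ∀ b ∈ A \ X, T.Adj z b → ∃ r, r ∉ A ∧ r ∉ E ∧ T.Adj z r) {S : Finset V}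
    (hS : S ⊆ (univ \ A) \ Y) (hne : S.Nonempty) :
    ∃ a ∈ S, ∃ b ∈ (univ \ A) \ S, T.Adj a b := by
  have hSA : ∀ s ∈ S, s ∉ A ∧ s ∉ Y := fun s hs => by simpa using hS hs
  have hYB : ∀ y ∈ Y, y ∉ A ∧ y ∉ S := fun y hy =>
    ⟨disjoint_right.1 hAY hy, fun h => (hSA y h).2 hy⟩
  by_contra! hcon
  have hSE : S ⊆ E := by
    intro s hs
    by_contra hsE
    obtain ⟨y, hy, hsy⟩ := hE s (hSA s hs).2 hsE
    exact hcon s hs y (by simpa using hYB y hy) hsy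
  obtain ⟨a, ha, b, hb, hab⟩ := hstrong S
    (fun s hs => by simp [(hSA s hs).1]) hne (by
      rintro rfl
      obtain ⟨y, hy⟩ := hY
      exact (hYB y hy).2 (by simp [(hYB y hy).1]))
  simp only [mem_sdiff, mem_univ, true_and, mem_inter, not_and] at hb
  by_cases hbA : b ∈ A
  · obtain ⟨r, hrA, hrE, har⟩ := hres a (hSE ha) b (mem_sdiff.2 ⟨hbA, hb.1 hbA⟩) hab
    exact hcon a ha r (by simpa [hrA] using fun h => hrE (hSE h)) har
  · exact hcon a ha b (by simp [hbA, hb.2]) hab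

open scoped Classical in
/-- Disjoint strong hubs `X` and `Y` can be grown to a partition into strong sets of prescribed
sizes. -/
theorem IsTournament.exists_partition [Fintype V] {T : Digr V} (hT : T.IsTournament)
    {X Y : Finset V} (hXY : Disjoint X Y) (hX : T.IsStrong X) (hY : T.IsStrong Y)
    (hYne : Y.Nonempty) (hdel : ∀ X' ⊆ X, T.IsStrong (univ \ X'))
    (hXcard : 20 * #X ≤ Fintype.card V) (hYcard : 20 * #Y ≤ Fintype.card V)
    (hEX : ∀ E : Finset V, Disjoint E X → Disjoint E Y → (∀ z ∈ E, ¬ T.Attached X z) →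
      20 * #E ≤ Fintype.card V)
    (hEY : ∀ E : Finset V, Disjoint E X → Disjoint E Y → (∀ z ∈ E, ¬ T.Attached Y z) →
      20 * #E ≤ Fintype.card V)
    {x : V} (hx : x ∈ X) {a : ℕ} (h3 : 3 ≤ a) (ha : 2 * a ≤ Fintype.card V) :
    ∃ A, x ∈ A ∧ Disjoint A Y ∧ #A = a ∧ T.IsStrong A ∧ T.IsStrong (univ \ A) := by
  set EX : Finset V := {z | z ∉ X ∧ z ∉ Y ∧ ¬ T.Attached X z} with hEXdef
  set EY : Finset V := {z | z ∉ Y ∧ ¬ T.Attached Y z} with hEYdef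
  have hEXcard : 20 * #EX ≤ Fintype.card V :=
    hEX EX (disjoint_left.2 fun z hz => by simp_all) (disjoint_left.2 fun z hz => by simp_all)
      fun z hz => by simp_all
  have hEYcard : 20 * #EY ≤ 2 * Fintype.card V := by
    have h1 := hEY (EY \ X) sdiff_disjoint (disjoint_left.2 fun z hz => by simp_all)
      fun z hz => by simp_all
    have h2 := card_le_card (s := EY) (t := (EY \ X) ∪ X) (by simp)
    have h3 := card_union_le (EY \ X) X
    omega
  have hchoose : ∀ G : Digr V, ∃ ρ : V → V, ∀ z w, G.Adj z w → w ∉ X ∪ EY →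
      G.Adj z (ρ z) ∧ ρ z ∉ X ∪ EY := by
    intro G
    refine ⟨fun z => if h : ∃ w, G.Adj z w ∧ w ∉ X ∪ EY then h.choose else z, ?_⟩
    intro z w hzw hw
    have h : ∃ w, G.Adj z w ∧ w ∉ X ∪ EY := ⟨w, hzw, hw⟩
    simp only [dif_pos h]
    exact h.choose_spec
  obtain ⟨ρ, hρ⟩ := hchoose T
  obtain ⟨σ, hσ⟩ := hchoose T.reverse
  set N := X ∪ Y ∪ EX ∪ EY ∪ (EY.image ρ ∪ EY.image σ) with hN
  have hXF : T.IsStrong (X ∪ univ \ N) := by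
    refine hX.of_attached subset_union_left fun z hz => ?_
    obtain ⟨hz, hzX⟩ := mem_sdiff.1 hz
    have hzN := (mem_sdiff.1 ((mem_union.1 hz).resolve_left hzX)).2
    by_contra hcon
    by_cases hzY : z ∈ Y
    · exact hzN (by simp [hN, hzY])
    · exact hzN (by simp [hN, hEXdef, hzX, hzY, hcon])
  have hcard : a ≤ #(X ∪ univ \ N) := by
    have h1 : (univ : Finset V) ⊆ (X ∪ univ \ N) ∪ (Y ∪ EX ∪ EY ∪ (EY.image ρ ∪ EY.image σ)) := by
      intro z _
      simp only [hN, mem_union, mem_sdiff, mem_univ, true_and]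
      tauto
    have h2 := (card_le_card h1).trans (card_union_le _ _)
    have h3 := card_union_le (Y ∪ EX ∪ EY) (EY.image ρ ∪ EY.image σ)
    have h4 := card_union_le (Y ∪ EX) EY
    have h5 := card_union_le Y EX
    have h6 := card_union_le (EY.image ρ) (EY.image σ)
    have h7 := card_image_le (s := EY) (f := ρ)
    have h8 := card_image_le (s := EY) (f := σ)
    rw [card_univ] at h2
    omega
  obtain ⟨A, hA, hxA, hAcard, hAs⟩ := hT.exists_strong_subset hXF (mem_union_left _ hx) h3 hcard
  have hAN : ∀ z ∈ A, z ∈ X ∨ z ∉ N := fun z hz => by simpa using hA hz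
  have hAY : Disjoint A Y := disjoint_left.2 fun z hz hzY => by
    rcases hAN z hz with h | h
    · exact disjoint_left.1 hXY h hzY
    · exact h (by simp [hN, hzY])
  have hdelA : T.IsStrong (univ \ (A ∩ X)) := hdel _ inter_subset_right
  have hres : ∀ (G : Digr V) (τ : V → V), EY.image τ ⊆ N →
      (∀ z w, G.Adj z w → w ∉ X ∪ EY → G.Adj z (τ z) ∧ τ z ∉ X ∪ EY) →
      ∀ z ∈ EY, ∀ b ∈ A \ X, G.Adj z b → ∃ r, r ∉ A ∧ r ∉ EY ∧ G.Adj z r := by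
    intro G τ hτN hτ z hz b hb hzb
    obtain ⟨hbA, hbX⟩ := mem_sdiff.1 hb
    have hbN := (hAN b hbA).resolve_left hbX
    obtain ⟨h1, h2⟩ := hτ z b hzb (by
      simp only [hN, mem_union, not_or] at hbN ⊢
      exact ⟨hbX, hbN.1.2⟩)
    rw [mem_union, not_or] at h2
    exact ⟨τ z, fun h => (hAN _ h).elim h2.1 fun h => h (hτN (mem_image_of_mem τ hz)), h2.2, h1⟩
  have hAtt : ∀ z ∉ Y, z ∉ EY → T.Attached Y z := fun z hz hzE => by
    by_contra hcon
    exact hzE (by simp [hEYdef, hz, hcon])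
  refine ⟨A, hxA, hAY, hAcard, hAs, hY.extend (fun y hy => ?_) (fun S hS hne => ?_)
    fun S hS hne => ?_⟩
  · simpa using disjoint_right.1 hAY hy
  · exact exists_adj_compl hYne hAY hdelA (fun z hz hzE => (hAtt z hz hzE).2)
      (hres T ρ (subset_union_left.trans subset_union_right) hρ) hS hne
  · obtain ⟨a, ha, b, hb, hab⟩ := exists_adj_compl hYne hAY hdelA.reverse
      (fun z hz hzE => (hAtt z hz hzE).1)
      (hres T.reverse σ (subset_union_right.trans subset_union_right) hσ) hS hne
    exact ⟨b, hb, a, ha, hab⟩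

theorem StronglyConnOn.isKStrong [Fintype V] {T : Digr V} {k : ℕ}
    (h : T.StronglyConnOn Set.univ k) : T.IsKStrong k univ := by
  intro D hD S hS ⟨u, hu⟩ hne
  obtain ⟨w, hw, hwS⟩ : ∃ w ∈ univ \ D, w ∉ S := by
    by_contra! hcon
    exact hne (hS.antisymm hcon)
  have huD : u ∉ D := (mem_sdiff.1 (hS hu)).2
  have hwD : w ∉ D := (mem_sdiff.1 hw).2
  obtain ⟨l, -, hch, hmem, hhead, hlast⟩ := h.2 u trivial w trivial (by rintro rfl; exact hwS hu) D
    (fun x hx => ⟨trivial, by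
      rintro (rfl | rfl)
      · exact huD hx
      · exact hwD hx⟩) (by rwa [Set.ncard_coe_finset])
  clear h hne
  induction l generalizing u with
  | nil => simp at hhead
  | cons x l ih =>
    obtain rfl : x = u := by simpa using hhead
    cases l with
    | nil =>
      obtain rfl : x = w := by simpa using hlast
      exact absurd hu hwS
    | cons y l =>
      obtain ⟨hxy, hch⟩ := List.isChain_cons_cons.1 hch
      have hyD : y ∉ D := (hmem y (by simp)).2
      by_cases hy : y ∈ S
      · exact ih y hy hyD hch (fun z hz => hmem z (List.mem_cons_of_mem _ hz)) rfl
          (by simpa using hlast)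
      · exact ⟨x, hu, y, by simp [hy, hyD], hxy⟩

open scoped Classical in
theorem IsTournament.exists_two_strong [Fintype V] {T : Digr V} (hT : T.IsTournament)
    (hK : T.IsKStrong 200 univ) (hcard : 2000 ≤ Fintype.card V) {ℓ : ℕ} (h3 : 3 ≤ ℓ)
    (hl : ℓ + 3 ≤ Fintype.card V) (v : V) :
    ∃ C : Finset V, v ∈ C ∧ #C = ℓ ∧ T.IsStrong C ∧ T.IsStrong (univ \ C) := by
  obtain ⟨U, -, hvU, hU, hUcard, hUE, hUdel⟩ :=
    hT.exists_hub hK (by norm_num) (by rw [card_univ]; omega) (mem_univ v)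
  rw [card_univ] at hUcard hUE
  have hGcard := card_sdiff_add_card_inter univ U
  rw [card_univ, univ_inter] at hGcard
  obtain ⟨w, hw⟩ : (univ \ U).Nonempty := card_pos.1 (by omega)
  obtain ⟨U', hU'G, hwU', hU', hU'card, hU'E, hU'del⟩ :=
    hT.exists_hub (hUdel U Subset.rfl) (by norm_num) (by omega) hw
  have hUU' : Disjoint U U' := disjoint_left.2 fun z hz hz' => (mem_sdiff.1 (hU'G hz')).2 hz
  have hattU : ∀ E : Finset V, Disjoint E U → Disjoint E U' → (∀ z ∈ E, ¬ T.Attached U z) →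
      20 * #E ≤ Fintype.card V := fun E h1 _ h => hUE E (by simpa [subset_sdiff] using h1) h
  have hattU' : ∀ E : Finset V, Disjoint E U → Disjoint E U' → (∀ z ∈ E, ¬ T.Attached U' z) →
      20 * #E ≤ Fintype.card V := fun E h1 h2 h =>
    (hU'E E (by simpa [subset_sdiff] using ⟨h1, h2⟩) h).trans (by omega)
  rcases le_total (2 * ℓ) (Fintype.card V) with hle | hle
  · obtain ⟨A, hvA, -, hAcard, hA, hB⟩ := hT.exists_partition hUU' hU hU' ⟨w, hwU'⟩
      (fun X' hX' => (hUdel X' hX').isStrong (by norm_num)) hUcard (by omega) hattU hattU' hvU h3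
      hle
    exact ⟨A, hvA, hAcard, hA, hB⟩
  · have hdel : ∀ X' ⊆ U', T.IsStrong (univ \ X') := by
      intro X' hX'
      obtain ⟨z, hz, hzU⟩ : ∃ z ∈ (univ \ U) \ U', T.Attached U z := by
        by_contra! hcon
        have h1 := hUE _ sdiff_subset hcon
        have h2 := le_card_sdiff U' (univ \ U)
        omega
      have hunion : univ \ X' = U ∪ (univ \ U) \ X' := by
        ext y
        have : y ∈ U → y ∉ X' := fun h h' => disjoint_left.1 hUU' h (hX' h')
        simp only [mem_sdiff, mem_univ, true_and, mem_union]
        tauto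
      rw [hunion]
      exact hU.union ((hU'del X' hX').isStrong (by norm_num))
        (disjoint_sdiff.mono_right sdiff_subset) (sdiff_subset_sdiff Subset.rfl hX' hz) hzU
    obtain ⟨A, -, hAU, hAcard, hA, hB⟩ := hT.exists_partition hUU'.symm hU' hU ⟨v, hvU⟩ hdel
      (by omega) hUcard (fun E h1 h2 => hattU' E h2 h1) (fun E h1 h2 => hattU E h2 h1) hwU'
      (a := Fintype.card V - ℓ) (by omega) (by omega)
    refine ⟨univ \ A, by simpa using disjoint_right.1 hAU hvU, ?_, hB, by simpa using hA⟩
    have := card_sdiff_add_card_inter univ A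
    rw [card_univ, univ_inter] at this
    omega

end Strong

end Digr

/-- **Corollary 2.5.** For `n ≥ 6` and `3 ≤ ℓ ≤ n - 3`, every strongly `10⁹`-connected
`n`-vertex tournament with a vertex `v` contains two vertex-disjoint cycles `C₁ ∋ v`
and `C₂` with `|V(C₁)| = ℓ` and `|V(C₂)| = n - ℓ`, partitioning the vertex set. -/
theorem stmt7 {V : Type} [Fintype V] (ℓ n : ℕ) (h6 : 6 ≤ n) (h3 : 3 ≤ ℓ)
    (hl : ℓ ≤ n - 3)
    (T : Digr V) (hT : T.IsTournament) (hn : Fintype.card V = n)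
    (hconn : T.StronglyConnOn Set.univ (10 ^ 9)) (v : V) :
    ∃ C₁ C₂ : Set V, Disjoint C₁ C₂ ∧ C₁ ∪ C₂ = Set.univ ∧ v ∈ C₁ ∧
      C₁.ncard = ℓ ∧ C₂.ncard = n - ℓ ∧
      (∃ l, T.IsCycleOn C₁ l) ∧ (∃ l, T.IsCycleOn C₂ l) := by
  classical
  have hcard : 10 ^ 9 + 1 ≤ Fintype.card V := by
    simpa [Set.ncard_univ, Nat.card_eq_fintype_card] using hconn.1
  have hK : T.IsKStrong 200 Finset.univ := fun D hD =>
    hconn.isKStrong D (hD.trans (by norm_num))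
  obtain ⟨C, hvC, hCcard, hC, hC'⟩ := hT.exists_two_strong hK (by omega) h3 (by omega) v
  have hC'card : (Finset.univ \ C).card = n - ℓ := by
    rw [← Finset.compl_eq_univ_sdiff, Finset.card_compl, hn, hCcard]
  refine ⟨C, (Finset.univ \ C : Finset V), ?_, ?_, hvC, ?_, ?_,
    hT.exists_isCycleOn hC (by omega), hT.exists_isCycleOn hC' (by omega)⟩
  · exact Finset.disjoint_coe.2 Finset.disjoint_sdiff
  · rw [← Finset.coe_union, Finset.union_sdiff_of_subset (Finset.subset_univ C), Finset.coe_univ]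
  · rw [Set.ncard_coe_finset, hCcard]
  · rw [Set.ncard_coe_finset, hC'card]
end

section
/- For all k, ℓ ∈ ℕ, every strongly (452k + 188ℓ)-connected digraph D on n vertices with δ(D) ≥ n − ℓ is k-linked. -/
open Digr

/-- `b` can be reached from `a` along edges of `G` using only vertices of `U`. -/
def LinkIn {V : Type} (G : V → V → Prop) (U : Set V) (a b : V) : Prop :=
  a ∈ U ∧ Relation.ReflTransGen (fun u v => G u v ∧ v ∈ U) a b

namespace LinkIn
variable {V : Type} {G H : V → V → Prop} {U W : Set V} {a b c : V}

theorem refl (h : a ∈ U) : LinkIn G U a a := ⟨h, .refl⟩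

theorem right_mem (h : LinkIn G U a b) : b ∈ U := by
  obtain ⟨ha, h⟩ := h
  induction h with
  | refl => exact ha
  | tail _ h _ => exact h.2

theorem mono (h : LinkIn G U a b) (hG : ∀ u ∈ U, ∀ v ∈ U, G u v → H u v) (hU : U ⊆ W) :
    LinkIn H W a b := by
  refine ⟨hU h.1, ?_⟩
  obtain ⟨ha, h⟩ := h
  have key : b ∈ U ∧ Relation.ReflTransGen (fun u v => H u v ∧ v ∈ W) a b := by
    induction h with
    | refl => exact ⟨ha, .refl⟩
    | tail _ h ih => exact ⟨h.2, ih.2.tail ⟨hG _ ih.1 _ h.2 h.1, hU h.2⟩⟩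
  exact key.2

theorem mono_set (h : LinkIn G U a b) (hU : U ⊆ W) : LinkIn G W a b :=
  h.mono (fun _ _ _ _ h => h) hU

theorem trans (h : LinkIn G U a b) (h' : LinkIn G U b c) : LinkIn G U a c :=
  ⟨h.1, h.2.trans h'.2⟩

theorem edge (ha : a ∈ U) (hb : b ∈ U) (h : G a b) : LinkIn G U a b :=
  ⟨ha, .single ⟨h, hb⟩⟩

theorem flip (h : LinkIn G U a b) : LinkIn (flip G) U b a := by
  obtain ⟨ha, h⟩ := h
  have key : b ∈ U ∧ LinkIn (_root_.flip G) U b a := by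
    induction h with
    | refl => exact ⟨ha, .refl ha⟩
    | tail _ h ih => exact ⟨h.2, (edge h.2 ih.1 h.1).trans ih.2⟩
  exact key.2

/-- Every link ending at `b` is trivial or enters `b` after a link avoiding `b`. -/
theorem eq_or_exists_avoiding (h : LinkIn G U a b) :
    a = b ∨ ∃ v, LinkIn G (U \ {b}) a v ∧ G v b := by
  by_contra! hc
  obtain ⟨hab, hc⟩ := hc
  have key : LinkIn G (U \ {b}) a b := by
    obtain ⟨ha, h⟩ := h
    have : ∀ v, Relation.ReflTransGen (fun u v => G u v ∧ v ∈ U) a v →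
        LinkIn G (U \ {b}) a v := by
      intro v hv
      induction hv with
      | refl => exact .refl ⟨ha, hab⟩
      | @tail u w _ huw ih =>
        have hw : w ≠ b := by
          rintro rfl
          exact hc _ ih huw.1
        exact ih.trans (edge ih.right_mem ⟨huw.2, hw⟩ huw.1)
    exact this b h
  exact key.right_mem.2 rfl

end LinkIn

/-- A family of pairwise disjoint vertex sets, each carrying a link from `A` to `B`. -/
def HasLinks {V : Type} (G : V → V → Prop) (A B : Finset V) (N : ℕ) : Prop :=
  ∃ U : Fin N → Set V, (∀ i j, i ≠ j → Disjoint (U i) (U j)) ∧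
    ∀ i, ∃ a ∈ A, ∃ b ∈ B, LinkIn G (U i) a b

/-- Every set of vertices meeting all links from `A` to `B` has at least `N` elements. -/
def SepBound {V : Type} (G : V → V → Prop) (A B : Finset V) (N : ℕ) : Prop :=
  ∀ S : Finset V, (∀ a ∈ A, ∀ b ∈ B, ¬ LinkIn G (↑S)ᶜ a b) → N ≤ S.card

section Menger
variable {V : Type} {G : V → V → Prop} {A B : Finset V} {N : ℕ}

theorem HasLinks.flip (h : HasLinks G A B N) : HasLinks (flip G) B A N := by
  obtain ⟨U, hU, h⟩ := h
  refine ⟨U, hU, fun i => ?_⟩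
  obtain ⟨a, ha, b, hb, h⟩ := h i
  exact ⟨b, hb, a, ha, h.flip⟩

theorem SepBound.flip (h : SepBound G A B N) : SepBound (flip G) B A N :=
  fun S hS => h S fun a ha b hb hl => hS b hb a ha hl.flip

open Classical in
/-- If `S` separates `A` from `B` in `G` without its edges from `x` to `y`, then links from `A` to
`S ∪ {x}` in that smaller graph are as hard to separate as links from `A` to `B` in `G`. -/
theorem SepBound.left_part {H : V → V → Prop} {S : Finset V} {x : V} (h : SepBound G A B N)
    (hH : ∀ u v, G u v → u ≠ x → H u v)
    (hS : ∀ a ∈ A, ∀ b ∈ B, ¬ LinkIn H (↑S)ᶜ a b) : SepBound H A (insert x S) N := by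
  intro S' hS'
  refine h S' fun a ha b hb hl => ?_
  have key : ∀ v, Relation.ReflTransGen (fun u v => G u v ∧ v ∈ (↑S' : Set V)ᶜ) a v →
      LinkIn H ((↑S')ᶜ ∩ (↑S)ᶜ) a v := by
    intro v hv
    induction hv with
    | refl =>
      refine .refl ⟨hl.1, fun haS => ?_⟩
      exact hS' a ha a (Finset.mem_insert_of_mem haS) (.refl hl.1)
    | @tail u w _ huw ih =>
      have hux : u ≠ x := by
        rintro rfl
        exact hS' a ha u (Finset.mem_insert_self _ _) (ih.mono_set Set.inter_subset_left)
      have hedge := hH _ _ huw.1 hux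
      refine ih.trans (.edge ih.right_mem ⟨huw.2, fun hwS => ?_⟩ hedge)
      exact hS' a ha w (Finset.mem_insert_of_mem hwS)
        ((ih.mono_set Set.inter_subset_left).trans
          (.edge ih.right_mem.1 huw.2 hedge))
  exact hS a ha b hb ((key b hl.2).mono_set Set.inter_subset_right)

open Classical in
/-- A full family of disjoint links from `A` onto a set `Z`, indexed by `Z` and trimmed so that every
vertex is reached from `A` avoiding the other vertices of `Z`. -/
theorem HasLinks.trimmed {Z : Finset V} (h : HasLinks G A Z N) (hZ : Z.card = N) :
    ∃ U : V → Set V, (∀ z ∈ Z, ∀ w ∈ Z, z ≠ w → Disjoint (U z) (U w)) ∧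
      (∀ z ∈ Z, ∃ a ∈ A, LinkIn G (U z) a z) ∧
      ∀ z ∈ Z, ∀ v ∈ U z, ∃ a ∈ A, LinkIn G ({v} ∪ {w | w ∉ Z}) a v := by
  obtain ⟨U, hU, h⟩ := h
  choose a ha b hb hl using h
  have hinj : Function.Injective b := by
    intro i j hij
    by_contra hne
    exact Set.disjoint_left.1 (hU i j hne) (hl i).right_mem (hij ▸ (hl j).right_mem)
  have himg : Finset.univ.image b = Z := by
    apply Finset.eq_of_subset_of_card_le
    · intro z hz
      obtain ⟨i, -, rfl⟩ := Finset.mem_image.1 hz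
      exact hb i
    · rw [Finset.card_image_of_injective _ hinj]; simp [hZ]
  have hsurj : ∀ z ∈ Z, ∃ i, b i = z := by
    intro z hz
    rw [← himg] at hz
    simpa using hz
  have honly : ∀ i, ∀ v ∈ U i, v ∈ Z → v = b i := by
    intro i v hv hvZ
    obtain ⟨j, rfl⟩ := hsurj v hvZ
    by_contra hne
    exact Set.disjoint_left.1 (hU j i (fun h => hne (by rw [h]))) (hl j).right_mem hv
  let T : Fin N → Set V := fun i => {b i} ∪ {v | LinkIn G (U i \ {b i}) (a i) v}
  have hTU : ∀ i, T i ⊆ U i := by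
    rintro i v (rfl | hv)
    · exact (hl i).right_mem
    · exact hv.right_mem.1
  have hTl : ∀ i, LinkIn G (T i) (a i) (b i) := by
    intro i
    rcases (hl i).eq_or_exists_avoiding with h | ⟨v, hv, hvb⟩
    · rw [h]; exact .refl (Or.inl rfl)
    · have key : ∀ z, Relation.ReflTransGen (fun u v => G u v ∧ v ∈ U i \ {b i}) (a i) z →
          LinkIn G (T i) (a i) z := by
        intro z hz
        induction hz with
        | refl => exact .refl (Or.inr (.refl hv.1))
        | tail h1 h2 ih =>
          exact ih.trans (.edge ih.right_mem (Or.inr ⟨hv.1, h1.tail h2⟩) h2.1)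
      have := key v hv.2
      exact this.trans (.edge this.right_mem (Or.inl rfl) hvb)
  rcases Z.eq_empty_or_nonempty with rfl | ⟨z₀, hz₀⟩
  · exact ⟨fun _ => ∅, by simp, by simp, by simp⟩
  have : Nonempty (Fin N) := ⟨(hsurj z₀ hz₀).choose⟩
  choose! g hg using hsurj
  refine ⟨fun z => T (g z), ?_, ?_, ?_⟩
  · intro z hz w hw hzw
    refine (hU (g z) (g w) ?_).mono (hTU _) (hTU _)
    intro h
    exact hzw (by rw [← hg z hz, ← hg w hw, h])
  · intro z hz
    exact ⟨a (g z), ha _, by simpa only [hg z hz] using hTl (g z)⟩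
  · intro z hz v hv
    refine ⟨a (g z), ha _, ?_⟩
    have hsub : ∀ w, w ∈ U (g z) \ {b (g z)} → w ∉ Z := fun w hw hwZ =>
      hw.2 (honly _ w hw.1 hwZ)
    rcases hv with rfl | hv
    · rcases (hl (g z)).eq_or_exists_avoiding with h | ⟨u, hu, hub⟩
      · rw [h]; exact .refl (Or.inl rfl)
      · have := hu.mono_set (W := {b (g z)} ∪ {w | w ∉ Z}) fun w hw => Or.inr (hsub w hw)
        exact this.trans (.edge this.right_mem (Or.inl rfl) hub)
    · exact LinkIn.mono_set hv fun w hw => Or.inr (hsub w hw)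

theorem HasLinks.mono {H : V → V → Prop} (h : HasLinks H A B N) (hH : ∀ u v, H u v → G u v) :
    HasLinks G A B N := by
  obtain ⟨U, hU, h⟩ := h
  refine ⟨U, hU, fun i => ?_⟩
  obtain ⟨a, ha, b, hb, h⟩ := h i
  exact ⟨a, ha, b, hb, h.mono (fun u _ v _ h => hH u v h) subset_rfl⟩

open Classical in
/-- Links from `A` to `S ∪ {x}` and from `S ∪ {y}` to `B` combine along the edge `x → y`. -/
theorem HasLinks.glue {H : V → V → Prop} {S : Finset V} {x y : V} (hHG : ∀ u v, H u v → G u v)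
    (hxy : G x y) (hS : ∀ a ∈ A, ∀ b ∈ B, ¬ LinkIn H (↑S)ᶜ a b)
    (hx : x ∉ S) (hy : y ∉ S) (hN : S.card + 1 = N)
    (h₁ : HasLinks H A (insert x S) N) (h₂ : HasLinks H (insert y S) B N) :
    HasLinks G A B N := by
  have hcx : (insert x S).card = N := by rw [Finset.card_insert_of_notMem hx, hN]
  have hcy : (insert y S).card = N := by rw [Finset.card_insert_of_notMem hy, hN]
  obtain ⟨U, hU, hUl, hUt⟩ := h₁.trimmed hcx
  obtain ⟨W, hW, hWl, hWt⟩ := h₂.flip.trimmed hcy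
  have hcross : ∀ s ∈ insert x S, ∀ t ∈ insert y S, ∀ v ∈ U s, v ∈ W t → v ∈ S := by
    intro s hs t ht v hvs hvt
    by_contra hv
    obtain ⟨a, ha, h1⟩ := hUt s hs v hvs
    obtain ⟨b, hb, h2⟩ := hWt t ht v hvt
    refine hS a ha b hb ((h1.mono_set ?_).trans (h2.flip.mono_set ?_))
    · rintro w (rfl | hw)
      · exact hv
      · exact fun hwS => hw (Finset.mem_insert_of_mem hwS)
    · rintro w (rfl | hw)
      · exact hv
      · exact fun hwS => hw (Finset.mem_insert_of_mem hwS)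
  have hUmem : ∀ z ∈ insert x S, z ∈ U z := fun z hz => (hUl z hz).choose_spec.2.right_mem
  have hWmem : ∀ z ∈ insert y S, z ∈ W z := fun z hz => (hWl z hz).choose_spec.2.right_mem
  have hUeq : ∀ s ∈ insert x S, ∀ v ∈ U s, v ∈ S → v = s := by
    intro s hs v hv hvS
    by_contra hne
    have hvx := Finset.mem_insert_of_mem (b := x) hvS
    exact Set.disjoint_left.1 (hU v hvx s hs hne) (hUmem v hvx) hv
  have hWeq : ∀ s ∈ insert y S, ∀ v ∈ W s, v ∈ S → v = s := by
    intro s hs v hv hvS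
    by_contra hne
    have hvx := Finset.mem_insert_of_mem (b := y) hvS
    exact Set.disjoint_left.1 (hW v hvx s hs hne) (hWmem v hvx) hv
  let τ : V → V := fun s => if s = x then y else s
  have hτ : ∀ s ∈ insert x S, τ s ∈ insert y S := by
    intro s hs
    by_cases h : s = x
    · simp [τ, h]
    · simp only [τ, h, if_false]
      exact Finset.mem_insert_of_mem (Finset.mem_of_mem_insert_of_ne hs h)
  have hτS : ∀ s ∈ insert x S, τ s ∈ S → τ s = s := by
    intro s hs h
    by_cases hsx : s = x
    · exact absurd (by simpa [τ, hsx] using h) hy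
    · simp [τ, hsx]
  have hτinj : ∀ s ∈ insert x S, ∀ t ∈ insert x S, τ s = τ t → s = t := by
    intro s hs t ht h
    by_cases hsx : s = x <;> by_cases htx : t = x
    · rw [hsx, htx]
    · have h2 := Finset.mem_of_mem_insert_of_ne ht htx
      simp only [τ, hsx, htx, if_true, if_false] at h
      exact absurd (h ▸ h2) hy
    · have h2 := Finset.mem_of_mem_insert_of_ne hs hsx
      simp only [τ, hsx, htx, if_true, if_false] at h
      exact absurd (h ▸ h2) hy
    · simpa only [τ, hsx, htx, if_false] using h
  let e : Fin N ≃ (insert x S : Finset V) := ((insert x S).equivFinOfCardEq hcx).symm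
  refine ⟨fun i => U (e i) ∪ W (τ (e i)), fun i j hij => ?_, fun i => ?_⟩
  · have hne : (e i : V) ≠ e j := fun h => hij (e.injective (Subtype.ext h))
    have hi := (e i).2
    have hj := (e j).2
    have hmixed : ∀ s ∈ insert x S, ∀ t ∈ insert x S, s ≠ t → Disjoint (U s) (W (τ t)) := by
      intro s hs t ht hst
      rw [Set.disjoint_left]
      intro v hvs hvt
      have hvS := hcross s hs _ (hτ t ht) v hvs hvt
      have h1 := hUeq s hs v hvs hvS
      have h2 := hWeq _ (hτ t ht) v hvt hvS
      exact hst (by rw [← h1, h2, hτS t ht (h2 ▸ hvS)])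
    rw [Set.disjoint_union_left, Set.disjoint_union_right, Set.disjoint_union_right]
    exact ⟨⟨hU _ hi _ hj hne, hmixed _ hi _ hj hne⟩, (hmixed _ hj _ hi hne.symm).symm,
      hW _ (hτ _ hi) _ (hτ _ hj) fun h => hne (hτinj _ hi _ hj h)⟩
  · change ∃ a ∈ A, ∃ b ∈ B, LinkIn G (U (e i) ∪ W (τ (e i))) a b
    obtain ⟨s, hs⟩ := e i
    obtain ⟨a, ha, h1⟩ := hUl s hs
    obtain ⟨b, hb, h2⟩ := hWl _ (hτ s hs)
    have h1' : LinkIn G (U s ∪ W (τ s)) a s :=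
      h1.mono (fun u _ v _ h => hHG u v h) Set.subset_union_left
    have h2' : LinkIn G (U s ∪ W (τ s)) (τ s) b :=
      h2.flip.mono (fun u _ v _ h => hHG u v h) Set.subset_union_right
    refine ⟨a, ha, b, hb, h1'.trans (LinkIn.trans ?_ h2')⟩
    by_cases hsx : s = x
    · refine .edge h1'.right_mem h2'.1 ?_
      simp only [τ, hsx, if_true]
      exact hxy
    · simp only [τ, hsx, if_false] at h1' ⊢
      exact .refl h1'.right_mem

open Classical in
/-- **Menger's theorem** for directed graphs, in the version for two vertex sets. -/
theorem SepBound.hasLinks [Fintype V] (h : SepBound G A B N) : HasLinks G A B N := by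
  suffices H : ∀ (n : ℕ) (E : Finset (V × V)) (A B : Finset V), E.card = n →
      SepBound (fun u v => (u, v) ∈ E) A B N → HasLinks (fun u v => (u, v) ∈ E) A B N by
    have := H _ (Finset.univ.filter fun p : V × V => G p.1 p.2) A B rfl
    simp only [Finset.mem_filter, Finset.mem_univ, true_and] at this
    exact this h
  intro n
  induction n with
  | zero =>
    intro E A B hE h
    rw [Finset.card_eq_zero] at hE
    subst hE
    have hAB : N ≤ (A ∩ B).card := by
      apply h
      rintro a ha b hb ⟨hm, hl⟩
      have hba : b = a := by
        rcases hl.cases_tail with h | ⟨c, -, h, -⟩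
        · exact h
        · simp at h
      subst hba
      simp [ha, hb] at hm
    obtain ⟨C, hC, hcard⟩ := Finset.exists_subset_card_eq hAB
    let e := (C.equivFinOfCardEq hcard).symm
    refine ⟨fun i => {(e i : V)}, fun i j hij => ?_, fun i => ?_⟩
    · rw [Set.disjoint_singleton]
      exact fun h => hij (e.injective (Subtype.ext h))
    · have := Finset.mem_inter.1 (hC (e i).2)
      exact ⟨e i, this.1, e i, this.2, .refl rfl⟩
  | succ n ih =>
    intro E A B hE h
    obtain ⟨⟨x, y⟩, hxy⟩ : E.Nonempty := by rw [← Finset.card_pos]; omega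
    have hE' : (E.erase (x, y)).card = n := by rw [Finset.card_erase_of_mem hxy]; omega
    have hsub : ∀ u v, (u, v) ∈ E.erase (x, y) → (u, v) ∈ E := fun u v h =>
      Finset.mem_of_mem_erase h
    by_cases hsep : SepBound (fun u v => (u, v) ∈ E.erase (x, y)) A B N
    · exact (ih _ A B hE' hsep).mono hsub
    · unfold SepBound at hsep
      push Not at hsep
      obtain ⟨S, hS, hSN⟩ := hsep
      have hx : N ≤ (insert x S).card := by
        refine h _ fun a ha b hb hl => hS a ha b hb (hl.mono (fun u hu v hv huv => ?_) ?_)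
        · refine Finset.mem_erase.2 ⟨fun heq => hu ?_, huv⟩
          simp [show u = x from (Prod.ext_iff.1 heq).1]
        · intro w hw hwS
          exact hw (by simp [Finset.mem_coe.1 hwS])
      have hy : N ≤ (insert y S).card := by
        refine h _ fun a ha b hb hl => hS a ha b hb (hl.mono (fun u hu v hv huv => ?_) ?_)
        · refine Finset.mem_erase.2 ⟨fun heq => hv ?_, huv⟩
          simp [show v = y from (Prod.ext_iff.1 heq).2]
        · intro w hw hwS
          exact hw (by simp [Finset.mem_coe.1 hwS])
      have hxS : x ∉ S := fun hm => by rw [Finset.insert_eq_of_mem hm] at hx; omega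
      have hyS : y ∉ S := fun hm => by rw [Finset.insert_eq_of_mem hm] at hy; omega
      rw [Finset.card_insert_of_notMem hxS] at hx
      have h1 := ih _ A (insert x S) hE' (h.left_part (fun u v huv hux =>
        Finset.mem_erase.2 ⟨fun heq => hux (Prod.ext_iff.1 heq).1, huv⟩) hS)
      have h2 : SepBound (_root_.flip fun u v => (u, v) ∈ E.erase (x, y)) B (insert y S) N :=
        h.flip.left_part (fun u v huv hux =>
          Finset.mem_erase.2 ⟨fun heq => hux (Prod.ext_iff.1 heq).2, huv⟩)
          fun b hb a ha hl => hS a ha b hb hl.flip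
      exact HasLinks.glue hsub hxy hS hxS hyS (by omega) h1 (ih _ _ B hE' h2.flip)

end Menger

section Choosing
open Classical
variable {V : Type}

theorem exists_max_subset (f : V → ℕ) (W : Finset V) :
    ∀ c ≤ W.card, ∃ P ⊆ W, P.card = c ∧ ∀ v ∈ W, v ∉ P → ∀ p ∈ P, f v ≤ f p := by
  intro c
  induction c with
  | zero => exact fun _ => ⟨∅, by simp, rfl, by simp⟩
  | succ c ih =>
    intro hc
    obtain ⟨P, hPW, hPc, hP⟩ := ih (by omega)
    have hne : (W \ P).Nonempty := by
      rw [← Finset.card_pos, Finset.card_sdiff_of_subset hPW]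
      omega
    obtain ⟨q, hq, hmax⟩ := Finset.exists_max_image (W \ P) f hne
    obtain ⟨hqW, hqP⟩ := Finset.mem_sdiff.1 hq
    refine ⟨insert q P, Finset.insert_subset hqW hPW, by
      rw [Finset.card_insert_of_notMem hqP, hPc], fun v hv hvP p hp => ?_⟩
    rw [Finset.mem_insert, not_or] at hvP
    rcases Finset.mem_insert.1 hp with rfl | hp
    · exact hmax v (Finset.mem_sdiff.2 ⟨hv, hvP.2⟩)
    · exact hP v hv hvP.2 p hp

theorem exists_injective_mem {ι α : Type*} [Fintype ι] (t : ι → Finset α)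
    (h : ∀ i, Fintype.card ι ≤ (t i).card) : ∃ f : ι → α, Function.Injective f ∧ ∀ i, f i ∈ t i := by
  refine (Finset.all_card_le_biUnion_card_iff_exists_injective t).1 fun s => ?_
  rcases s.eq_empty_or_nonempty with rfl | ⟨i, hi⟩
  · simp
  · exact (Finset.card_le_univ s).trans
      ((h i).trans (Finset.card_le_card (Finset.subset_biUnion_of_mem t hi)))

/-- Pairwise disjoint small sets can be chosen greedily. -/
theorem exists_disjoint_connectors {ι : Type*} [Fintype ι] (good : ι → Finset V → Prop)
    (F : Finset V) (s : ℕ) (hs : F.card + 2 * Fintype.card ι ≤ s)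
    (h : ∀ i S, F ⊆ S → S.card ≤ s → ∃ K : Finset V, K.card ≤ 2 ∧ Disjoint K S ∧ good i K) :
    ∃ K : ι → Finset V, (∀ i, Disjoint (K i) F) ∧ (∀ i j, i ≠ j → Disjoint (K i) (K j)) ∧
      ∀ i, good i (K i) := by
  suffices H : ∀ I : Finset ι, ∃ K : ι → Finset V, (∀ i ∈ I, Disjoint (K i) F) ∧
      (∀ i ∈ I, ∀ j ∈ I, i ≠ j → Disjoint (K i) (K j)) ∧ ∀ i ∈ I, (K i).card ≤ 2 ∧ good i (K i) by
    obtain ⟨K, h1, h2, h3⟩ := H Finset.univ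
    exact ⟨K, fun i => h1 i (Finset.mem_univ _),
      fun i j => h2 i (Finset.mem_univ _) j (Finset.mem_univ _),
      fun i => (h3 i (Finset.mem_univ _)).2⟩
  intro I
  induction I using Finset.induction_on with
  | empty => exact ⟨fun _ => ∅, by simp, by simp, by simp⟩
  | insert i I hi ih =>
    obtain ⟨K, h1, h2, h3⟩ := ih
    have hcard : (F ∪ I.biUnion K).card ≤ s := by
      have hb : (I.biUnion K).card ≤ I.card * 2 :=
        Finset.card_biUnion_le_card_mul _ _ _ fun j hj => (h3 j hj).1
      have := Finset.card_union_le F (I.biUnion K)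
      have := Finset.card_le_univ I
      omega
    obtain ⟨K₀, hc, hd, hg⟩ := h i _ Finset.subset_union_left hcard
    rw [Finset.disjoint_union_right, Finset.disjoint_biUnion_right] at hd
    have hne : ∀ j ∈ I, j ≠ i := fun j hj h => hi (h ▸ hj)
    refine ⟨Function.update K i K₀, ?_, ?_, ?_⟩
    · intro j hj
      rcases Finset.mem_insert.1 hj with rfl | hj
      · simpa using hd.1
      · simpa [Function.update_of_ne (hne j hj)] using h1 j hj
    · intro j hj j' hj' hjj
      rcases Finset.mem_insert.1 hj with rfl | hj₁ <;> rcases Finset.mem_insert.1 hj' with rfl | hj₂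
      · exact absurd rfl hjj
      · simpa [Function.update_of_ne (hne j' hj₂)] using hd.2 j' hj₂
      · simpa [Function.update_of_ne (hne j hj₁)] using (hd.2 j hj₁).symm
      · simpa [Function.update_of_ne (hne j hj₁), Function.update_of_ne (hne j' hj₂)] using
          h2 j hj₁ j' hj₂ hjj
    · intro j hj
      rcases Finset.mem_insert.1 hj with rfl | hj
      · simpa using ⟨hc, hg⟩
      · simpa [Function.update_of_ne (hne j hj)] using h3 j hj

/-- If every element of `α` owns two elements of `β` in two different ways, one of each can be
chosen without conflicts, together with further elements owned by nobody. -/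
theorem exists_assignment {α β : Type*} [Fintype α] [Fintype β]
    {p q : α × Bool → β} (hp : Function.Injective p) (hq : Function.Injective q)
    (hcard : 5 * Fintype.card α ≤ Fintype.card β) :
    ∃ f : Option Bool × α → β, Function.Injective f ∧ (∀ a, ∃ e, f (some true, a) = p (a, e)) ∧
      (∀ a, ∃ e, f (some false, a) = q (a, e)) ∧
      ∀ a, f (none, a) ∉ Set.range p ∧ f (none, a) ∉ Set.range q := by
  let t : Bool × α → Finset β := fun c =>
    Finset.univ.image fun e => if c.1 = true then p (c.2, e) else q (c.2, e)
  have hall : ∀ s : Finset (Bool × α), s.card ≤ (s.biUnion t).card := by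
    intro s
    have hslice : ∀ b : Bool, 2 * (s.filter fun c => c.1 = b).card ≤ (s.biUnion t).card := by
      intro b
      have hinj : Function.Injective (fun c : α × Bool => if b = true then p c else q c) := by
        cases b
        · simpa using hq
        · simpa using hp
      have hsub : (((s.filter fun c => c.1 = b).image Prod.snd) ×ˢ (Finset.univ : Finset Bool)).image
          (fun c : α × Bool => if b = true then p c else q c) ⊆ s.biUnion t := by
        intro v hv
        obtain ⟨⟨a, e⟩, hae, rfl⟩ := Finset.mem_image.1 hv
        obtain ⟨⟨b', a'⟩, hc, rfl⟩ := Finset.mem_image.1 (Finset.mem_product.1 hae).1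
        obtain ⟨hcs, rfl⟩ := Finset.mem_filter.1 hc
        exact Finset.mem_biUnion.2 ⟨_, hcs, Finset.mem_image.2 ⟨e, Finset.mem_univ _, rfl⟩⟩
      have hle := Finset.card_le_card hsub
      rw [Finset.card_image_of_injective _ hinj, Finset.card_product, Finset.card_image_of_injOn]
        at hle
      · simpa [mul_comm] using hle
      · rintro ⟨b1, a1⟩ h1 ⟨b2, a2⟩ h2 h
        simp only [Finset.coe_filter, Set.mem_ofPred_eq] at h1 h2
        exact Prod.ext (h1.2.trans h2.2.symm) h
    have hsplit := Finset.card_filter_add_card_filter_not (s := s) (fun c => c.1 = true)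
    have h1 := hslice true
    have h2 := hslice false
    simp only [Bool.not_eq_true] at hsplit
    omega
  obtain ⟨f, hf, hft⟩ := (Finset.all_card_le_biUnion_card_iff_exists_injective t).1 hall
  have hC : Fintype.card α ≤
      (Finset.univ \ (Finset.univ.image p ∪ Finset.univ.image q)).card := by
    have h1 := Finset.le_card_sdiff (Finset.univ.image p ∪ Finset.univ.image q) Finset.univ
    have h2 := Finset.card_union_le (Finset.univ.image p) (Finset.univ.image q)
    rw [Finset.card_image_of_injective _ hp, Finset.card_image_of_injective _ hq] at h2
    simp only [Finset.card_univ, Fintype.card_prod, Fintype.card_bool] at h1 h2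
    omega
  obtain ⟨r, hr, hrC⟩ := exists_injective_mem
    (fun _ : α => Finset.univ \ (Finset.univ.image p ∪ Finset.univ.image q)) fun _ => hC
  have hrmem : ∀ a, r a ∉ Set.range p ∧ r a ∉ Set.range q := by
    intro a
    have := hrC a
    simpa [not_or] using this
  have hfmem : ∀ c, f c ∈ Set.range p ∨ f c ∈ Set.range q := by
    intro c
    obtain ⟨e, -, he⟩ := Finset.mem_image.1 (hft c)
    rw [← he]
    split_ifs
    · exact Or.inl ⟨_, rfl⟩
    · exact Or.inr ⟨_, rfl⟩
  have hne : ∀ c a, f c ≠ r a := by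
    intro c a h
    rcases hfmem c with h' | h'
    · exact (hrmem a).1 (h ▸ h')
    · exact (hrmem a).2 (h ▸ h')
  refine ⟨fun c => c.1.elim (r c.2) fun b => f (b, c.2), ?_, ?_, ?_, hrmem⟩
  · rintro ⟨o, a⟩ ⟨o', a'⟩ h
    cases o <;> cases o' <;> simp only [Option.elim] at h
    · rw [hr h]
    · exact absurd h.symm (hne _ _)
    · exact absurd h (hne _ _)
    · have := hf h
      simp only [Prod.mk.injEq] at this
      rw [this.1, this.2]
  · intro a
    obtain ⟨e, -, he⟩ := Finset.mem_image.1 (hft (true, a))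
    exact ⟨e, by simpa using he.symm⟩
  · intro a
    obtain ⟨e, -, he⟩ := Finset.mem_image.1 (hft (false, a))
    exact ⟨e, by simpa using he.symm⟩

end Choosing

section Counting
open Classical
variable {V : Type} [Fintype V] {G : V → V → Prop} {ℓ : ℕ}

/-- The set of out-neighbours of `v`; in-neighbours are `outs (flip G) v`. -/
noncomputable def outs (G : V → V → Prop) (v : V) : Finset V := Finset.univ.filter (G v)

theorem mem_outs {u v : V} : u ∈ outs G v ↔ G v u := by simp [outs]

/-- Every vertex is non-adjacent to at most `ℓ` other vertices. -/
def FewMissing (G : V → V → Prop) (ℓ : ℕ) : Prop :=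
  ∀ v, (Finset.univ.filter fun u => u ≠ v ∧ ¬ G v u ∧ ¬ G u v).card ≤ ℓ

theorem FewMissing.flip (h : FewMissing G ℓ) : FewMissing (flip G) ℓ := by
  intro v
  refine le_trans (Finset.card_le_card fun u hu => ?_) (h v)
  simp only [Finset.mem_filter, Finset.mem_univ, true_and] at hu ⊢
  exact ⟨hu.1, hu.2.2, hu.2.1⟩

theorem FewMissing.card_le (h : FewMissing G ℓ) {Z : Finset V} {r : ℕ}
    (hZ : ∀ z ∈ Z, (Z.filter (G z)).card ≤ r) : Z.card ≤ 2 * r + ℓ + 1 := by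
  rcases Z.eq_empty_or_nonempty with rfl | hne
  · simp
  have hpt : ∀ z ∈ Z, Z.card ≤
      (1 + ℓ) + ((Z.filter (G z)).card + (Z.filter fun u => G u z).card) := by
    intro z _
    have hsub : Z ⊆ ({z} ∪ Finset.univ.filter fun u => u ≠ z ∧ ¬ G z u ∧ ¬ G u z) ∪
        (Z.filter (G z) ∪ Z.filter fun u => G u z) := by
      intro u hu
      simp only [Finset.mem_union, Finset.mem_filter, Finset.mem_univ, true_and,
        Finset.mem_singleton, hu]
      tauto
    refine (Finset.card_le_card hsub).trans ((Finset.card_union_le _ _).trans ?_)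
    refine Nat.add_le_add ((Finset.card_union_le _ _).trans ?_) (Finset.card_union_le _ _)
    exact Nat.add_le_add (by simp) (h z)
  have hsum := Finset.sum_le_sum hpt
  have hswap : ∑ z ∈ Z, (Z.filter (G z)).card = ∑ z ∈ Z, (Z.filter fun u => G u z).card :=
    Finset.sum_card_bipartiteAbove_eq_sum_card_bipartiteBelow G
  have hr : ∑ z ∈ Z, (Z.filter (G z)).card ≤ Z.card * r := by
    simpa using Finset.sum_le_card_nsmul Z _ r hZ
  simp only [Finset.sum_add_distrib, Finset.sum_const, smul_eq_mul, ← hswap] at hsum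
  have : Z.card * Z.card ≤ Z.card * (2 * r + ℓ + 1) := by nlinarith
  exact Nat.le_of_mul_le_mul_left this hne.card_pos

/-- Out of a vertex `p` of nearly maximal out-degree, every vertex of large in-degree can be reached
in at most three steps, even after deleting a small vertex set. -/
theorem FewMissing.exists_short_link (h : FewMissing G ℓ) {T P S : Finset V} {p w : V} {d s : ℕ}
    (hp : ∀ v, v ∉ T → v ∉ P → (outs G v).card ≤ (outs G p).card)
    (hTS : T ⊆ S) (hS : S.card ≤ s) (hw : d ≤ (outs (_root_.flip G) w).card)
    (hd : 3 * s + 3 * ℓ + P.card + 2 ≤ d) :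
    (∃ z, z ∉ S ∧ G p z ∧ G z w) ∨ ∃ z z', z ∉ S ∧ z' ∉ S ∧ G p z ∧ G z z' ∧ G z' w := by
  by_contra! hc
  obtain ⟨hc1, hc2⟩ := hc
  let A := outs G p \ S
  let Z := (outs (_root_.flip G) w \ S) \ P
  have hA : (outs G p).card ≤ A.card + s := by
    have := Finset.le_card_sdiff S (outs G p)
    change _ ≤ A.card at this
    omega
  have hZ : d ≤ Z.card + s + P.card := by
    have h1 := Finset.le_card_sdiff S (outs (_root_.flip G) w)
    have h2 := Finset.le_card_sdiff P (outs (_root_.flip G) w \ S)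
    change _ ≤ Z.card at h2
    omega
  have hAmem : ∀ a, a ∈ A ↔ G p a ∧ a ∉ S := by simp [A, mem_outs]
  have hZmem : ∀ b, b ∈ Z ↔ (G b w ∧ b ∉ S) ∧ b ∉ P := by simp [Z, mem_outs, _root_.flip]
  have hout : ∀ b ∈ Z, (Z.filter (G b)).card ≤ s + ℓ := by
    intro b hb
    obtain ⟨⟨hbw, hbS⟩, hbP⟩ := (hZmem b).1 hb
    have hmax := hp b (fun hbT => hbS (hTS hbT)) hbP
    have hdisj : Disjoint A (Z.filter (G b)) := by
      rw [Finset.disjoint_left]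
      intro a ha ha'
      have ha := (hAmem a).1 ha
      exact hc1 a ha.2 ha.1 ((hZmem a).1 (Finset.mem_filter.1 ha').1).1.1
    have hsub : A ∪ Z.filter (G b) ⊆
        outs G b ∪ Finset.univ.filter fun u => u ≠ b ∧ ¬ G b u ∧ ¬ G u b := by
      intro a ha
      rw [Finset.mem_union, mem_outs, Finset.mem_filter]
      rcases Finset.mem_union.1 ha with ha | ha
      · obtain ⟨hpa, haS⟩ := (hAmem a).1 ha
        by_cases hba : G b a
        · exact Or.inl hba
        · refine Or.inr ⟨Finset.mem_univ _, ?_, hba, fun hab => hc2 a b haS hbS hpa hab hbw⟩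
          rintro rfl
          exact hc1 a hbS hpa hbw
      · exact Or.inl (Finset.mem_filter.1 ha).2
    have h1 := (Finset.card_le_card hsub).trans (Finset.card_union_le _ _)
    rw [Finset.card_union_of_disjoint hdisj] at h1
    have := h b
    omega
  have := h.card_le hout
  omega

/-- A set `P` of vertices of largest out-degree outside `T`, and disjoint families of vertices of
out-degree at least `d`, which are in-neighbours of `y j` for those `j` which need it. -/
theorem exists_top_and_targets {T : Finset V} {k m d : ℕ} (y : Fin k → V) (bad : Fin k → Prop)
    (hL : 5 * (k * m) ≤ (Finset.univ.filter (fun v => d ≤ (outs G v).card) \ T).card)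
    (hbad : ∀ j, bad j → 5 * (k * m) ≤
      ((outs (flip G) (y j)).filter (fun v => d ≤ (outs G v).card) \ T).card) :
    ∃ P : Finset V, P.card = 3 * (k * m) ∧ (∀ p ∈ P, p ∉ T ∧ d ≤ (outs G p).card) ∧
      (∀ v, v ∉ T → v ∉ P → ∀ p ∈ P, (outs G v).card ≤ (outs G p).card) ∧
      ∃ g : (Fin k × Fin m) × Bool → V, Function.Injective g ∧
        ∀ c, g c ∉ T ∧ g c ∉ P ∧ d ≤ (outs G (g c)).card ∧ (bad c.1.1 → G (g c) (y c.1.1)) := by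
  let L := Finset.univ.filter (fun v => d ≤ (outs G v).card) \ T
  have hLc : 3 * (k * m) ≤ (Finset.univ \ T).card :=
    (by omega : 3 * (k * m) ≤ 5 * (k * m)).trans (hL.trans (Finset.card_le_card
      (Finset.sdiff_subset_sdiff (Finset.subset_univ _) subset_rfl)))
  obtain ⟨P, hPT, hPc, hP⟩ := exists_max_subset (fun v => (outs G v).card) _ _ hLc
  have hPmem : ∀ p ∈ P, p ∉ T := fun p hp => (Finset.mem_sdiff.1 (hPT hp)).2
  have hPd : ∀ p ∈ P, d ≤ (outs G p).card := by
    intro p hp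
    by_contra hlt
    have hsub : L ⊆ P.erase p := by
      intro v hv
      obtain ⟨hv, hvT⟩ := Finset.mem_sdiff.1 hv
      have hvd := (Finset.mem_filter.1 hv).2
      refine Finset.mem_erase.2 ⟨fun h => hlt (h ▸ hvd), ?_⟩
      by_contra hvP
      exact hlt (hvd.trans (hP v (by simp [hvT]) hvP p hp))
    have h1 := Finset.card_le_card hsub
    rw [Finset.card_erase_of_mem hp, hPc] at h1
    have := Finset.card_pos.2 ⟨p, hp⟩
    change _ ≤ L.card at hL
    omega
  refine ⟨P, hPc, fun p hp => ⟨hPmem p hp, hPd p hp⟩,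
    fun v hvT hvP p hp => hP v (by simp [hvT]) hvP p hp, ?_⟩
  let t : (Fin k × Fin m) × Bool → Finset V := fun c =>
    (if bad c.1.1 then (outs (flip G) (y c.1.1)).filter (fun v => d ≤ (outs G v).card) \ T
      else L) \ P
  obtain ⟨g, hg, hgt⟩ := exists_injective_mem t (by
    intro c
    have h5 : 5 * (k * m) ≤ (if bad c.1.1 then
        (outs (flip G) (y c.1.1)).filter (fun v => d ≤ (outs G v).card) \ T else L).card := by
      split_ifs with h
      · exact hbad _ h
      · exact hL
    have := Finset.le_card_sdiff P (if bad c.1.1 then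
        (outs (flip G) (y c.1.1)).filter (fun v => d ≤ (outs G v).card) \ T else L)
    simp only [Fintype.card_prod, Fintype.card_fin, Fintype.card_bool]
    change _ ≤ (t c).card at this
    omega)
  refine ⟨g, hg, fun c => ?_⟩
  have hc := hgt c
  simp only [t] at hc
  split_ifs at hc with h
  · simp only [Finset.mem_sdiff, Finset.mem_filter, mem_outs, flip] at hc
    exact ⟨hc.1.2, hc.2, hc.1.1.2, fun _ => hc.1.1.1⟩
  · simp only [L, Finset.mem_sdiff, Finset.mem_filter, Finset.mem_univ, true_and] at hc
    exact ⟨hc.1.2, hc.2, hc.1.1, fun hb => absurd hb h⟩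

end Counting

section Linkage
open Classical
variable {V : Type} {G : V → V → Prop}

theorem LinkIn.diff_of_restrict {T U : Set V} {a b : V}
    (h : LinkIn (fun u v => G u v ∧ u ∉ T ∧ v ∉ T) U a b) (ha : a ∉ T) : LinkIn G (U \ T) a b := by
  obtain ⟨hm, h⟩ := h
  induction h with
  | refl => exact .refl ⟨hm, ha⟩
  | tail _ h ih => exact ih.trans (.edge ih.right_mem ⟨h.2, h.1.2.2⟩ h.1.1)

variable [Fintype V]

theorem le_card_outs {c : ℕ} (hcard : c + 1 ≤ Fintype.card V)
    (hconn : ∀ S : Finset V, S.card < c → ∀ u, u ∉ S → ∀ v, v ∉ S → LinkIn G (↑S)ᶜ u v) (v : V) :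
    c ≤ (outs G v).card := by
  by_contra! hlt
  have hS : ((outs G v).erase v).card < c := (Finset.card_erase_le).trans_lt hlt
  obtain ⟨u, hu⟩ : ∃ u, u ∉ insert v ((outs G v).erase v) := by
    by_contra! hall
    have h1 : (Finset.univ : Finset V).card ≤ _ := Finset.card_le_card fun u _ => hall u
    have h2 := Finset.card_insert_le v ((outs G v).erase v)
    rw [Finset.card_univ] at h1
    omega
  rw [Finset.mem_insert, not_or] at hu
  obtain ⟨-, hl⟩ := hconn _ hS v (by simp) u hu.2
  have key : u = v := by
    induction hl with
    | refl => rfl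
    | @tail w z hw h ih =>
      have hz : z ∉ (outs G v).erase v := h.2
      by_contra hne
      by_cases hwv : w = v
      · subst hwv
        exact hz (Finset.mem_erase.2 ⟨hne, mem_outs.2 h.1⟩)
      · refine hwv (ih ⟨hwv, fun hm => ?_⟩)
        rcases hw.cases_tail with h' | ⟨_, _, h'⟩
        · exact hwv h'
        · exact h'.2 hm
  exact hu.1 key

theorem le_card_of_few_high {c d t r : ℕ} {v : V} {W T : Finset V}
    (hd : ∀ v, d ≤ (outs G v).card ∨ d ≤ (outs (flip G) v).card) (hdeg : c ≤ (outs G v).card)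
    (hW : W ⊆ T) (hT : T.card ≤ t)
    (hfew : ((outs G v).filter (fun u => d ≤ (outs G u).card) \ W).card < r) :
    c ≤ ((outs G v).filter (fun u => d ≤ (outs (flip G) u).card) \ T).card + t + r := by
  have hsub : outs G v ⊆ ((outs G v).filter (fun u => d ≤ (outs (flip G) u).card) \ T ∪ T) ∪
      ((outs G v).filter (fun u => d ≤ (outs G u).card) \ W) := by
    intro u hu
    simp only [Finset.mem_union, Finset.mem_sdiff, Finset.mem_filter, hu, true_and]
    have := hd u
    have := @hW u
    tauto
  have h1 := (Finset.card_le_card hsub).trans (Finset.card_union_le _ _)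
  have h2 := Finset.card_union_le ((outs G v).filter (fun u => d ≤ (outs (flip G) u).card) \ T) T
  omega

theorem FewMissing.le_card_high {ℓ d t : ℕ} (h : FewMissing G ℓ) {T : Finset V} (hT : T.card ≤ t) :
    Fintype.card V ≤
      (Finset.univ.filter (fun v => d ≤ (outs G v).card) \ T).card + t + (2 * d + ℓ + 1) := by
  have hlow : (Finset.univ.filter fun v => ¬ d ≤ (outs G v).card).card ≤ 2 * d + ℓ + 1 := by
    refine h.card_le fun z hz => ?_
    have h1 : ¬ d ≤ (outs G z).card := (Finset.mem_filter.1 hz).2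
    have h2 : (Finset.filter (G z) (Finset.univ.filter fun v => ¬ d ≤ (outs G v).card)).card ≤
        (outs G z).card :=
      Finset.card_le_card fun u hu => mem_outs.2 (Finset.mem_filter.1 hu).2
    omega
  have hsplit := Finset.card_filter_add_card_filter_not (s := (Finset.univ : Finset V))
    (fun v => d ≤ (outs G v).card)
  have hs := Finset.le_card_sdiff T (Finset.univ.filter (fun v => d ≤ (outs G v).card))
  rw [Finset.card_univ] at hsplit
  omega

theorem FewMissing.card_le_degrees {ℓ : ℕ} (h : FewMissing G ℓ) (v : V) :
    Fintype.card V ≤ (outs G v).card + (outs (_root_.flip G) v).card + ℓ + 1 := by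
  have hsub : (Finset.univ : Finset V) ⊆ (outs G v ∪ outs (_root_.flip G) v) ∪
      ((Finset.univ.filter fun u => u ≠ v ∧ ¬ G v u ∧ ¬ G u v) ∪ {v}) := by
    intro u _
    simp only [Finset.mem_union, mem_outs, Finset.mem_filter, Finset.mem_univ, true_and,
      Finset.mem_singleton, _root_.flip]
    tauto
  have h1 := (Finset.card_le_card hsub).trans (Finset.card_union_le _ _)
  have h2 := Finset.card_union_le (outs G v) (outs (_root_.flip G) v)
  have h3 := Finset.card_union_le (Finset.univ.filter fun u => u ≠ v ∧ ¬ G v u ∧ ¬ G u v) {v}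
  have h4 := h v
  rw [Finset.card_univ] at h1
  rw [Finset.card_singleton] at h3
  omega

/-- Disjoint links in a highly connected digraph, avoiding `T`, from each vertex of `A` and to each
vertex of `B`. -/
theorem exists_links_avoiding {c N : ℕ} {T A B : Finset V}
    (hconn : ∀ S : Finset V, S.card < c → ∀ u, u ∉ S → ∀ v, v ∉ S → LinkIn G (↑S)ᶜ u v)
    (hc : T.card + N ≤ c) (hA : A.card = N) (hB : B.card = N) (hAT : ∀ a ∈ A, a ∉ T)
    (hBT : ∀ b ∈ B, b ∉ T) :
    ∃ (U : Fin N → Finset V) (a b : Fin N → V), (∀ i j, i ≠ j → Disjoint (U i) (U j)) ∧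
      (∀ i, Disjoint (U i) T) ∧ (∀ i, LinkIn G (U i) (a i) (b i)) ∧
      (∀ i, a i ∈ A) ∧ (∀ i, b i ∈ B) ∧ (∀ v ∈ A, ∃ i, a i = v) ∧ ∀ v ∈ B, ∃ i, b i = v := by
  have hsep : SepBound (fun u v => G u v ∧ u ∉ (T : Set V) ∧ v ∉ (T : Set V)) A B N := by
    intro S hS
    by_contra! hlt
    obtain ⟨a, haA, haS⟩ := Finset.exists_mem_notMem_of_card_lt_card (hA.symm ▸ hlt)
    obtain ⟨b, hbB, hbS⟩ := Finset.exists_mem_notMem_of_card_lt_card (hB.symm ▸ hlt)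
    have hST : (S ∪ T).card < c := by
      have := Finset.card_union_le S T
      omega
    have hl := hconn _ hST a (by simp [haS, hAT a haA]) b (by simp [hbS, hBT b hbB])
    refine hS a haA b hbB (hl.mono (fun u hu v hv h => ⟨h, ?_, ?_⟩) ?_)
    · intro hm
      exact hu (by simp [Finset.mem_coe.1 hm])
    · intro hm
      exact hv (by simp [Finset.mem_coe.1 hm])
    · intro w hw hm
      exact hw (by simp [Finset.mem_coe.1 hm])
  obtain ⟨U, hU, h⟩ := hsep.hasLinks
  choose a ha b hb hl using h
  have hl' : ∀ i, LinkIn G (U i \ T) (a i) (b i) := fun i =>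
    (hl i).diff_of_restrict (hAT _ (ha i))
  have hsurj : ∀ (f : Fin N → V) (C : Finset V), C.card = N → (∀ i, f i ∈ C) →
      (∀ i, f i ∈ U i) → ∀ v ∈ C, ∃ i, f i = v := by
    intro f C hC hfC hfU v hv
    have hinj : Function.Injective f := by
      intro i j hij
      by_contra hne
      exact Set.disjoint_left.1 (hU i j hne) (hfU i) (hij ▸ hfU j)
    have himg : Finset.univ.image f = C := by
      apply Finset.eq_of_subset_of_card_le
      · intro z hz
        obtain ⟨i, -, rfl⟩ := Finset.mem_image.1 hz
        exact hfC i
      · rw [Finset.card_image_of_injective _ hinj]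
        simp [hC]
    rw [← himg] at hv
    simpa using hv
  refine ⟨fun i => (U i \ T).toFinset, a, b, fun i j hij => ?_, fun i => ?_, fun i => ?_, ha, hb,
    hsurj a A hA ha fun i => (hl i).1, hsurj b B hB hb fun i => (hl i).right_mem⟩
  · rw [Set.disjoint_toFinset]
    exact (hU i j hij).mono Set.sdiff_subset Set.sdiff_subset
  · rw [Finset.disjoint_left]
    intro v hv hvT
    exact (Set.mem_toFinset.1 hv).2 hvT
  · rw [Set.coe_toFinset]
    exact hl' i

/-- Among `m` groups of `k` disjoint sets some group covers at most a `1 / m` fraction. -/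
theorem exists_small_group {ι κ : Type*} [Fintype ι] [Fintype κ] [Nonempty κ]
    {U : ι × κ → Finset V} (hU : ∀ i j, i ≠ j → Disjoint (U i) (U j)) :
    ∃ a, Fintype.card κ * ∑ i, (U (i, a)).card ≤ Fintype.card V := by
  have htot : ∑ a, ∑ i, (U (i, a)).card ≤ Fintype.card V := by
    rw [Finset.sum_comm, ← Fintype.sum_prod_type (f := fun p => (U p).card),
      ← Finset.card_biUnion fun i _ j _ h => hU i j h]
    exact Finset.card_le_univ _
  obtain ⟨a, -, ha⟩ := Finset.exists_min_image Finset.univ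
    (fun a => ∑ i, (U (i, a)).card) Finset.univ_nonempty
  refine ⟨a, le_trans ?_ htot⟩
  simpa using Finset.card_nsmul_le_sum Finset.univ _ _ ha

end Linkage

section Assembly
open Classical
variable {V : Type} {G : V → V → Prop} [Fintype V] {ℓ : ℕ}

theorem FewMissing.exists_connector (h : FewMissing G ℓ) {T P S : Finset V} {p w : V} {d s : ℕ}
    (hp : ∀ v, v ∉ T → v ∉ P → (outs G v).card ≤ (outs G p).card)
    (hTS : T ⊆ S) (hS : S.card ≤ s) (hw : d ≤ (outs (_root_.flip G) w).card)
    (hd : 3 * s + 3 * ℓ + P.card + 2 ≤ d) :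
    ∃ K : Finset V, K.card ≤ 2 ∧ Disjoint K S ∧ LinkIn G (↑K ∪ {p, w}) p w := by
  rcases h.exists_short_link hp hTS hS hw hd with ⟨z, hz, h1, h2⟩ | ⟨z, z', hz, hz', h1, h2, h3⟩
  · refine ⟨{z}, by simp, by simpa using hz, ?_⟩
    exact (LinkIn.edge (b := z) (by simp) (by simp) h1).trans (.edge (by simp) (by simp) h2)
  · refine ⟨{z, z'}, Finset.card_le_two, ?_, ?_⟩
    · simp [Finset.disjoint_left, hz, hz']
    · exact ((LinkIn.edge (b := z) (by simp) (by simp) h1).trans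
        (.edge (b := z') (by simp) (by simp) h2)).trans (.edge (by simp) (by simp) h3)

/-- Initial, middle and final pieces are joined up through vertices of nearly maximal degree. -/
theorem FewMissing.exists_disjoint_links (h : FewMissing G ℓ) {k d s : ℕ} {T P Q F : Finset V}
    {C : Option Bool × Fin k → Finset V} (hC : ∀ i j, i ≠ j → Disjoint (C i) (C j))
    (hTF : T ⊆ F) (hCF : ∀ i, C i ⊆ F) (hF : F.card + 4 * k ≤ s)
    (hP : ∀ v, v ∉ T → v ∉ P → ∀ p ∈ P, (outs G v).card ≤ (outs G p).card)
    (hQ : ∀ v, v ∉ T → v ∉ Q → ∀ q ∈ Q, (outs (_root_.flip G) v).card ≤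
      (outs (_root_.flip G) q).card)
    (hdP : 3 * s + 3 * ℓ + P.card + 2 ≤ d) (hdQ : 3 * s + 3 * ℓ + Q.card + 2 ≤ d)
    {x y : Fin k → V}
    (hx : ∀ i, ∃ u, d ≤ (outs G u).card ∧ LinkIn G (C (some true, i)) (x i) u)
    (hy : ∀ i, ∃ w, d ≤ (outs (_root_.flip G) w).card ∧ LinkIn G (C (some false, i)) w (y i))
    (hm : ∀ i, ∃ q ∈ Q, ∃ p ∈ P, LinkIn G (C (none, i)) q p) :
    ∃ Z : Fin k → Set V, (∀ i j, i ≠ j → Disjoint (Z i) (Z j)) ∧ ∀ i, LinkIn G (Z i) (x i) (y i) := by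
  choose u hud hu using hx
  choose w hwd hw using hy
  choose q hq p hp hqp using hm
  obtain ⟨K, hKF, hK, hlink⟩ := exists_disjoint_connectors
    (fun (c : Bool × Fin k) K => if c.1 = true then LinkIn G (↑K ∪ {q c.2, u c.2}) (u c.2) (q c.2)
      else LinkIn G (↑K ∪ {p c.2, w c.2}) (p c.2) (w c.2)) F s
    (by
      simp only [Fintype.card_prod, Fintype.card_bool, Fintype.card_fin]
      omega)
    (by
      rintro ⟨b, i⟩ S hFS hS
      cases b
      · simpa using h.exists_connector (fun v h1 h2 => hP v h1 h2 _ (hp i)) (hTF.trans hFS) hS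
          (hwd i) hdP
      · obtain ⟨K, h1, h2, h3⟩ := h.flip.exists_connector
          (fun v h1 h2 => hQ v h1 h2 _ (hq i)) (hTF.trans hFS) hS (hud i) hdQ
        exact ⟨K, h1, h2, by simpa using h3.flip⟩)
  let Y : Fin k → Finset V := fun i =>
    (C (some true, i) ∪ C (none, i) ∪ C (some false, i)) ∪ (K (true, i) ∪ K (false, i))
  refine ⟨fun i => Y i, fun i j hij => ?_, fun i => ?_⟩
  · have h1 : ∀ a b, Disjoint (C (a, i)) (C (b, j)) := fun a b =>
      hC _ _ fun h => hij (congrArg Prod.snd h)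
    have h2 : ∀ a b, Disjoint (K (a, i)) (K (b, j)) := fun a b =>
      hK _ _ fun h => hij (congrArg Prod.snd h)
    have h3 : ∀ a b i j, Disjoint (K (a, i)) (C (b, j)) := fun a b i j =>
      (hKF _).mono_right (hCF _)
    have h4 : ∀ a b i j, Disjoint (C (b, j)) (K (a, i)) := fun a b i j => (h3 a b i j).symm
    simp [Y, h1, h2, h3, h4]
  · have hl1 := hlink (true, i)
    have hl2 := hlink (false, i)
    simp only [if_true, Bool.false_eq_true, if_false] at hl1 hl2
    have hu' := (hu i).right_mem
    have hw' := (hw i).1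
    have hq' := (hqp i).1
    have hp' := (hqp i).right_mem
    simp only [Finset.mem_coe] at hu' hw' hq' hp'
    refine ((((hu i).mono_set ?_).trans (hl1.mono_set ?_)).trans ((hqp i).mono_set ?_)).trans
      ((hl2.mono_set ?_).trans ((hw i).mono_set ?_))
    all_goals
      intro v hv
      simp only [Set.mem_union, Finset.mem_coe, Set.mem_insert_iff, Set.mem_singleton_iff] at hv
      simp only [Y, Finset.mem_coe, Finset.mem_union]
      first
        | tauto
        | (rcases hv with hv | rfl | rfl <;> tauto)

/-- Each terminal has a private neighbour of large degree, or few such neighbours at all. -/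
theorem exists_private_neighbours {ι : Type*} [Fintype ι] (H : ι → V → V → Prop) (z : ι → V) (d : ℕ)
    (hcard : 2 * Fintype.card ι ≤ Fintype.card V) :
    ∃ r : ι → V, Function.Injective r ∧ (∀ i j, r i ≠ z j) ∧
      ∀ i, (H i (z i) (r i) ∧ d ≤ (outs (H i) (r i)).card) ∨
        ((outs (H i) (z i)).filter (fun v => d ≤ (outs (H i) v).card) \
          Finset.univ.image z).card < Fintype.card ι := by
  let R : ι → Finset V := fun i =>
    (outs (H i) (z i)).filter (fun v => d ≤ (outs (H i) v).card) \ Finset.univ.image z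
  obtain ⟨r, hr, hrm⟩ := exists_injective_mem
    (fun i => if Fintype.card ι ≤ (R i).card then R i else Finset.univ \ Finset.univ.image z) (by
      intro i
      split_ifs with h
      · exact h
      · have h1 := Finset.le_card_sdiff (Finset.univ.image z) Finset.univ
        have h2 : (Finset.univ.image z).card ≤ _ := Finset.card_image_le
        rw [Finset.card_univ] at h1 h2
        omega)
  refine ⟨r, hr, fun i j h => ?_, fun i => ?_⟩
  · have := hrm i
    split_ifs at this
    all_goals exact (Finset.mem_sdiff.1 this).2 (by simp [h])
  · by_cases h : Fintype.card ι ≤ (R i).card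
    · have := hrm i
      rw [if_pos h] at this
      have := Finset.mem_filter.1 (Finset.mem_sdiff.1 this).1
      exact Or.inl ⟨mem_outs.1 this.1, this.2⟩
    · exact Or.inr (not_le.1 h)

end Assembly

section Core
open Classical
variable {V : Type} {G : V → V → Prop} [Fintype V] {ℓ : ℕ}

theorem exists_linkage (hmiss : FewMissing G ℓ) {k c : ℕ} (hk : 1 ≤ k)
    (hc : 452 * k + 188 * ℓ ≤ c) (hcard : c + 1 ≤ Fintype.card V)
    (hconn : ∀ S : Finset V, S.card < c → ∀ u, u ∉ S → ∀ v, v ∉ S → LinkIn G (↑S)ᶜ u v)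
    (x y : Fin k → V) (hinj : Function.Injective (Sum.elim x y)) :
    ∃ Z : Fin k → Set V, (∀ i j, i ≠ j → Disjoint (Z i) (Z j)) ∧ ∀ i, LinkIn G (Z i) (x i) (y i) := by
  obtain ⟨s, hs⟩ : ∃ s, s = Fintype.card V / 16 + 8 * k := ⟨_, rfl⟩
  obtain ⟨d, hd⟩ : ∃ d, d = 3 * s + 3 * ℓ + 48 * k + 2 := ⟨_, rfl⟩
  have hdn : 2 * d + ℓ + 1 + 84 * k ≤ Fintype.card V := by omega
  have hconn' : ∀ S : Finset V, S.card < c → ∀ u, u ∉ S → ∀ v, v ∉ S →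
      LinkIn (flip G) (↑S)ᶜ u v := fun S hS u hu v hv => (hconn S hS v hv u hu).flip
  have hdeg := le_card_outs hcard hconn
  have hdeg' := le_card_outs hcard hconn'
  have hhigh : ∀ v, d ≤ (outs G v).card ∨ d ≤ (outs (flip G) v).card := fun v => by
    have := hmiss.card_le_degrees v
    omega
  let z : Bool × Fin k → V := fun e => cond e.1 (x e.2) (y e.2)
  have hz : Function.Injective z := by
    rintro ⟨b, i⟩ ⟨b', j⟩ h
    cases b <;> cases b' <;> simp only [z, cond_true, cond_false] at h
    · have := hinj (a₁ := Sum.inr i) (a₂ := Sum.inr j) h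
      simpa using this
    · have := hinj (a₁ := Sum.inr i) (a₂ := Sum.inl j) h
      simp at this
    · have := hinj (a₁ := Sum.inl i) (a₂ := Sum.inr j) h
      simp at this
    · have := hinj (a₁ := Sum.inl i) (a₂ := Sum.inl j) h
      simpa using this
  obtain ⟨r, hr, hrz, hrd⟩ := exists_private_neighbours
    (fun e : Bool × Fin k => cond e.1 G (flip G)) z d (by
      simp only [Fintype.card_prod, Fintype.card_bool, Fintype.card_fin]
      omega)
  have hι : Fintype.card (Bool × Fin k) = 2 * k := by simp
  rw [hι] at hrd
  let T : Finset V := Finset.univ.image z ∪ Finset.univ.image r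
  have hT : T.card ≤ 4 * k := by
    have h1 := Finset.card_union_le (Finset.univ.image z) (Finset.univ.image r)
    have h2 : (Finset.univ.image z).card ≤ Fintype.card (Bool × Fin k) := Finset.card_image_le
    have h3 : (Finset.univ.image r).card ≤ Fintype.card (Bool × Fin k) := Finset.card_image_le
    change T.card ≤ _ at h1
    omega
  have hzT : ∀ e, z e ∈ T := fun e => by simp [T]
  have hrT : ∀ e, r e ∈ T := fun e => by simp [T]
  obtain ⟨P, hPc, hPd, hP, gY, hgY, hgY'⟩ := exists_top_and_targets (G := G) (T := T) (k := k)
    (m := 16) (d := d) y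
    (fun j => ¬ (G (r (false, j)) (y j) ∧ d ≤ (outs (flip G) (r (false, j))).card))
    (by
      have := hmiss.le_card_high (d := d) hT
      omega)
    (by
      intro j hj
      have := le_card_of_few_high (fun v => (hhigh v).symm) (hdeg' (y j))
        Finset.subset_union_left hT ((hrd (false, j)).resolve_left hj)
      change c ≤ ((outs (flip G) (y j)).filter (fun v => d ≤ (outs G v).card) \ T).card + _ + _
        at this
      omega)
  obtain ⟨Q, hQc, hQd, hQ, gX, hgX, hgX'⟩ := exists_top_and_targets (G := flip G) (T := T) (k := k)
    (m := 16) (d := d) x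
    (fun j => ¬ (G (x j) (r (true, j)) ∧ d ≤ (outs G (r (true, j))).card))
    (by
      have := hmiss.flip.le_card_high (d := d) hT
      omega)
    (by
      intro j hj
      have := le_card_of_few_high hhigh (hdeg (x j))
        Finset.subset_union_left hT ((hrd (true, j)).resolve_left hj)
      change c ≤ ((outs G (x j)).filter (fun v => d ≤ (outs (flip G) v).card) \ T).card + _ + _
        at this
      change _ ≤ ((outs G (x j)).filter (fun v => d ≤ (outs (flip G) v).card) \ T).card
      omega)
  have hunion : ∀ (R : Finset V) (g : (Fin k × Fin 16) × Bool → V), R.card = 3 * (k * 16) →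
      Function.Injective g → (∀ e, g e ∉ R) → (R ∪ Finset.univ.image g).card = 80 * k := by
    intro R g hR hg hgR
    rw [Finset.card_union_of_disjoint, Finset.card_image_of_injective _ hg, hR]
    · simp only [Finset.card_univ, Fintype.card_prod, Fintype.card_bool, Fintype.card_fin]
      omega
    · rw [Finset.disjoint_right]
      intro v hv
      obtain ⟨e, -, rfl⟩ := Finset.mem_image.1 hv
      exact hgR e
  have hA : ∀ v ∈ Q ∪ Finset.univ.image gX, v ∉ T ∧ d ≤ (outs (flip G) v).card := by
    intro v hv
    rcases Finset.mem_union.1 hv with hv | hv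
    · exact hQd v hv
    · obtain ⟨e, -, rfl⟩ := Finset.mem_image.1 hv
      exact ⟨(hgX' e).1, (hgX' e).2.2.1⟩
  have hB : ∀ v ∈ P ∪ Finset.univ.image gY, v ∉ T ∧ d ≤ (outs G v).card := by
    intro v hv
    rcases Finset.mem_union.1 hv with hv | hv
    · exact hPd v hv
    · obtain ⟨e, -, rfl⟩ := Finset.mem_image.1 hv
      exact ⟨(hgY' e).1, (hgY' e).2.2.1⟩
  obtain ⟨U, a, b, hU, hUT, hlink, haA, hbB, ha, hb⟩ := exists_links_avoiding (T := T) hconn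
    (by omega) (hunion Q gX hQc hgX fun e => (hgX' e).2.1)
    (hunion P gY hPc hgY fun e => (hgY' e).2.1) (fun v hv => (hA v hv).1) (fun v hv => (hB v hv).1)
  have hUinj : ∀ i j v, v ∈ U i → v ∈ U j → i = j := by
    intro i j v hi hj
    by_contra hne
    exact Finset.disjoint_left.1 (hU i j hne) hi hj
  have hainj : Function.Injective a := fun i j h =>
    hUinj i j (a i) (hlink i).1 (h ▸ (hlink j).1)
  have hbinj : Function.Injective b := fun i j h =>
    hUinj i j (b i) (hlink i).right_mem (h ▸ (hlink j).right_mem)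
  choose ix hix using fun e => ha (gX e) (by simp)
  choose iy hiy using fun e => hb (gY e) (by simp)
  obtain ⟨f, hf, hfx, hfy, hf0⟩ := exists_assignment
    (p := ix) (q := iy)
    (fun e e' h => hgX (by rw [← hix, ← hix, h]))
    (fun e e' h => hgY (by rw [← hiy, ← hiy, h])) (by
      simp only [Fintype.card_prod, Fintype.card_fin]
      omega)
  obtain ⟨t, ht⟩ := exists_small_group (ι := Option Bool × Fin k) (κ := Fin 16)
    (U := fun e => U (f (e.1.1, (e.1.2, e.2)))) (by
      rintro ⟨⟨o, i⟩, t⟩ ⟨⟨o', i'⟩, t'⟩ hne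
      refine hU _ _ fun h => hne ?_
      have := hf h
      simp only [Prod.mk.injEq] at this ⊢
      tauto)
  simp only [Fintype.card_fin] at ht
  let W : Option Bool × Fin k → Finset V := fun e => U (f (e.1, (e.2, t)))
  let E : Option Bool × Fin k → Finset V := fun e =>
    e.1.elim ∅ fun b => {z (b, e.2), r (b, e.2)}
  have hET : ∀ e, E e ⊆ T := by
    rintro ⟨o, i⟩
    cases o
    · simp [E]
    · simp [E, Finset.insert_subset_iff, hzT, hrT]
  have hEE : ∀ e e', e ≠ e' → Disjoint (E e) (E e') := by
    rintro ⟨o, i⟩ ⟨o', i'⟩ hne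
    cases o with
    | none => simp [E]
    | some b =>
      cases o' with
      | none => simp [E]
      | some b' =>
        have hne' : (b, i) ≠ (b', i') := by
          simpa using hne
        simp [E, hz.ne hne'.symm, hr.ne hne'.symm, hrz, (hrz _ _).symm]
  have hWW : ∀ e e', e ≠ e' → Disjoint (W e) (W e') := by
    rintro ⟨o, i⟩ ⟨o', i'⟩ hne
    refine hU _ _ fun h => hne ?_
    have := hf h
    simp only [Prod.mk.injEq] at this ⊢
    tauto
  have hWE : ∀ e e', Disjoint (W e) (E e') := fun e e' => (hUT _).mono_right (hET e')
  have hWF : ∀ e, W e ⊆ T ∪ Finset.univ.biUnion W := fun e =>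
    (Finset.subset_biUnion_of_mem W (Finset.mem_univ e)).trans Finset.subset_union_right
  refine hmiss.exists_disjoint_links (d := d) (s := s) (T := T) (P := P) (Q := Q)
    (F := T ∪ Finset.univ.biUnion W) (C := fun e => E e ∪ W e) ?_ Finset.subset_union_left
    ?_ ?_ hP hQ (by omega) (by omega) ?_ ?_ ?_
  · intro e e' hne
    simp [hEE e e' hne, hWW e e' hne, hWE, (hWE _ _).symm]
  · exact fun e => Finset.union_subset ((hET e).trans Finset.subset_union_left) (hWF e)
  · have h1 := Finset.card_union_le T (Finset.univ.biUnion W)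
    have h2 : (Finset.univ.biUnion W).card ≤ ∑ e, (W e).card := Finset.card_biUnion_le
    change 16 * ∑ e, (W e).card ≤ _ at ht
    omega
  · intro i
    by_cases hg : G (x i) (r (true, i)) ∧ d ≤ (outs G (r (true, i))).card
    · exact ⟨_, hg.2, .edge (by simp [E, z]) (by simp [E]) hg.1⟩
    · obtain ⟨e, he⟩ := hfx (i, t)
      have hl := hlink (f (some true, (i, t)))
      have hG : G (x i) (a (f (some true, (i, t)))) := by
        rw [he, hix]
        exact (hgX' ((i, t), e)).2.2.2 hg
      refine ⟨b (f (some true, (i, t))), (hB _ (hbB _)).2, .trans (.edge (by simp [E, z]) ?_ hG)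
        (hl.mono_set ?_)⟩
      · exact Finset.mem_coe.2 (Finset.mem_union_right _ hl.1)
      · exact Finset.coe_subset.2 Finset.subset_union_right
  · intro i
    by_cases hg : G (r (false, i)) (y i) ∧ d ≤ (outs (flip G) (r (false, i))).card
    · exact ⟨_, hg.2, .edge (by simp [E]) (by simp [E, z]) hg.1⟩
    · obtain ⟨e, he⟩ := hfy (i, t)
      have hl := hlink (f (some false, (i, t)))
      have hG : G (b (f (some false, (i, t)))) (y i) := by
        rw [he, hiy]
        exact (hgY' ((i, t), e)).2.2.2 hg
      refine ⟨a (f (some false, (i, t))), (hA _ (haA _)).2, .trans (hl.mono_set ?_)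
        (.edge ?_ (by simp [E, z]) hG)⟩
      · exact Finset.coe_subset.2 Finset.subset_union_right
      · exact Finset.mem_coe.2 (Finset.mem_union_right _ hl.right_mem)
  · intro i
    obtain ⟨h1, h2⟩ := hf0 (i, t)
    refine ⟨a (f (none, (i, t))), ?_, b (f (none, (i, t))), ?_,
      (hlink _).mono_set (Finset.coe_subset.2 Finset.subset_union_right)⟩
    · refine (Finset.mem_union.1 (haA _)).resolve_right fun hm => h1 ?_
      obtain ⟨e, -, he⟩ := Finset.mem_image.1 hm
      exact ⟨e, hainj ((hix e).trans he)⟩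
    · refine (Finset.mem_union.1 (hbB _)).resolve_right fun hm => h2 ?_
      obtain ⟨e, -, he⟩ := Finset.mem_image.1 hm
      exact ⟨e, hbinj ((hiy e).trans he)⟩

end Core

section Paths
open Classical
variable {V : Type}

theorem LinkIn.of_list {G : V → V → Prop} {A : Set V} {u v : V} {l : List V} (hl : l.IsChain G)
    (hA : ∀ x ∈ l, x ∈ A) (hu : l.head? = some u) (hv : l.getLast? = some v) : LinkIn G A u v := by
  induction l generalizing u with
  | nil => simp at hu
  | cons a l ih =>
    obtain rfl : a = u := by simpa using hu
    cases l with
    | nil =>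
      obtain rfl : a = v := by simpa using hv
      exact .refl (hA _ (by simp))
    | cons b l =>
      rw [List.isChain_cons_cons] at hl
      exact (LinkIn.edge (hA _ (by simp)) (hA _ (by simp)) hl.1).trans
        (ih hl.2 (fun x hx => hA x (List.mem_cons_of_mem _ hx)) rfl
          (by rwa [List.getLast?_cons_cons] at hv))

theorem LinkIn.exists_isPathOn {D : Digr V} {A : Set V} {u v : V} (h : LinkIn D.Adj A u v) :
    ∃ l, D.IsPathOn A u v l := by
  obtain ⟨hu, h⟩ := h
  induction h with
  | refl => exact ⟨[u], by simp, List.isChain_singleton _, by simpa using hu, rfl, rfl⟩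
  | @tail v w _ hvw ih =>
    obtain ⟨l, hnd, hch, hA, hh, hlast⟩ := ih
    by_cases hw : w ∈ l
    · obtain ⟨l₁, l₂, rfl⟩ := List.append_of_mem hw
      have hpre : l₁ ++ [w] <+: l₁ ++ w :: l₂ := ⟨l₂, by simp⟩
      refine ⟨l₁ ++ [w], hnd.sublist hpre.sublist, List.IsChain.prefix hch hpre,
        fun x hx => hA x (hpre.subset hx), ?_, by simp⟩
      rw [← hh]
      cases l₁ <;> simp
    · refine ⟨l ++ [w], ?_, ?_, ?_, ?_, by simp⟩
      · simpa [List.nodup_append, hnd] using fun a ha (h : a = w) => hw (h ▸ ha)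
      · refine List.IsChain.append hch (List.isChain_singleton _) ?_
        intro a ha b hb
        rw [hlast] at ha
        obtain rfl : v = a := by simpa using ha
        obtain rfl : w = b := by simpa using hb
        exact hvw.1
      · intro x hx
        rcases List.mem_append.1 hx with hx | hx
        · exact hA x hx
        · rw [List.mem_singleton.1 hx]
          exact hvw.2
      · simp [List.head?_append, hh]

variable {D : Digr V}

theorem linkIn_of_stronglyConnOn {c : ℕ} (hconn : D.StronglyConnOn Set.univ c) (S : Finset V)
    (hS : S.card < c) (u : V) (hu : u ∉ S) (v : V) (hv : v ∉ S) : LinkIn D.Adj (↑S)ᶜ u v := by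
  by_cases huv : u = v
  · exact huv ▸ .refl hu
  · obtain ⟨l, -, hch, hA, hh, hlast⟩ := hconn.2 u trivial v trivial huv (↑S) (by
      intro x hx
      refine ⟨trivial, ?_⟩
      rintro (rfl | rfl)
      · exact hu hx
      · exact hv hx) (by rwa [Set.ncard_coe_finset])
    exact .of_list hch (fun x hx => (hA x hx).2) hh hlast

theorem fewMissing_of_le_ncard [Fintype V] {ℓ : ℕ}
    (hδ : ∀ v, Fintype.card V - ℓ ≤ (D.outN v ∪ D.inN v).ncard) : FewMissing D.Adj ℓ := by
  intro v
  have hdisj : Disjoint (Finset.univ.filter fun u => u ≠ v ∧ ¬ D.Adj v u ∧ ¬ D.Adj u v)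
      (D.outN v ∪ D.inN v).toFinset := by
    rw [Finset.disjoint_left]
    intro u hu hu'
    obtain ⟨-, h1, h2⟩ := (Finset.mem_filter.1 hu).2
    rcases Set.mem_toFinset.1 hu' with h | h
    · exact h1 h
    · exact h2 h
  have h1 := Finset.card_le_univ ((Finset.univ.filter fun u => u ≠ v ∧ ¬ D.Adj v u ∧ ¬ D.Adj u v) ∪
    (D.outN v ∪ D.inN v).toFinset)
  rw [Finset.card_union_of_disjoint hdisj, ← Set.ncard_eq_toFinset_card'] at h1
  have := hδ v
  omega

end Paths

/-- **Corollary 2.8.** Every strongly `(452k + 188ℓ)`-connected digraph on `n` vertices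
with `δ(D) ≥ n - ℓ` is `k`-linked. -/
theorem stmt9 {V : Type} [Fintype V] (k ℓ n : ℕ) (D : Digr V) (hn : Fintype.card V = n)
    (hδ : ∀ v, n - ℓ ≤ (D.outN v ∪ D.inN v).ncard)
    (hconn : D.StronglyConnOn Set.univ (452 * k + 188 * ℓ)) :
    2 * k ≤ Fintype.card V ∧
    ∀ x y : Fin k → V, Function.Injective (Sum.elim x y : Fin k ⊕ Fin k → V) →
      ∃ P : Fin k → List V,
        (∀ i j, i ≠ j → ∀ v, v ∈ P i → v ∉ P j) ∧
        ∀ i, D.IsPathOn Set.univ (x i) (y i) (P i) := by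
  have hcard := hconn.1
  rw [Set.ncard_univ, Nat.card_eq_fintype_card] at hcard
  refine ⟨by omega, fun x y hinj => ?_⟩
  rcases Nat.eq_zero_or_pos k with rfl | hk
  · exact ⟨fun _ => [], fun i => i.elim0, fun i => i.elim0⟩
  · subst hn
    obtain ⟨Z, hZ, hl⟩ := exists_linkage (fewMissing_of_le_ncard hδ) hk le_rfl hcard
      (linkIn_of_stronglyConnOn hconn) x y hinj
    choose P hP using fun i => (hl i).exists_isPathOn
    refine ⟨P, fun i j hij v hi hj => ?_, fun i => ?_⟩
    · exact Set.disjoint_left.1 (hZ i j hij) ((hP i).2.2.1 v hi) ((hP j).2.2.1 v hj)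
    · obtain ⟨h1, h2, -, h4⟩ := hP i
      exact ⟨h1, h2, fun _ _ => trivial, h4⟩
end
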